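/- arXiv:2408.12876 — 4 statements merged into one kernel-verified Lean document; each statement's English description precedes it below -/
import Mathlib

section
/- For every M ∈ ℕ there exist constants C > 0 and c > 0 such that for every n ∈ ℕ* and every ℓ ∈ ℤ (with no restriction relating ℓ and n), | a^{⋆n}_ℓ − Σ_{k=1}^{K} Σ_{m=0}^{M} κ_k^{−ℓ} F_a(κ_k)^n n^{−(m+1)/(2μ_k)} (P_{k,m}(−d/dx) H_{2μ_k}^{β_k})((ℓ − α_k n)/n^{1/(2μ_k)}) | ≤ C e^{−c n} + C Σ_{k=1}^{K} n^{−(M+2)/(2μ_k)} exp( −c (|ℓ − α_k n| / n^{1/(2μ_k)})^{2μ_k/(2μ_k−1)} ). -/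
open Complex

/-- Convolution of two complex-valued sequences over `ℤ`. -/
noncomputable def conv (a b : ℤ → ℂ) : ℤ → ℂ := fun ℓ => ∑' ℓ' : ℤ, a (ℓ - ℓ') * b ℓ'

/-- `iterConv a n` is the iterated convolution `a^{⋆(n+1)}`:
`iterConv a 0 = a^{⋆1} = a` and `iterConv a (n+1) = iterConv a n ⋆ a`. -/
noncomputable def iterConv (a : ℤ → ℂ) : ℕ → ℤ → ℂ
  | 0 => a
  | n + 1 => conv (iterConv a n) a

/-- The generalized Gaussian `H_{2μ}^β (x) = (1/2π) ∫_ℝ e^{-i x θ} e^{-β θ^{2μ}} dθ`. -/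
noncomputable def Hfun (μ : ℕ) (β : ℂ) : ℝ → ℂ :=
  fun x => (1 / (2 * Real.pi : ℂ)) *
    ∫ θ : ℝ, Complex.exp (-Complex.I * x * θ) * Complex.exp (-β * (θ : ℂ) ^ (2 * μ))

/-- The function `(P_m (-d/dx)) H` where
`P_m (X) = X^m ∑_{⟨ν⟩ = m} X^{2μ|ν|}/ν! ∏_{j ≥ 1} (γ_{2μ+j}/(2μ+j)!)^{ν_j}`,
the sum running over finitely supported sequences `ν` of nonnegative integers with
`⟨ν⟩ = ∑_j j ν_j = m`, encoded by partitions `p` of `m` (`ν_j` being the number of parts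
of `p` equal to `j`); in particular `P_0 = 1`. -/
noncomputable def PdiffH (μ : ℕ) (γ : ℕ → ℂ) (m : ℕ) (H : ℝ → ℂ) : ℝ → ℂ :=
  fun x => ∑ p : Nat.Partition m,
    (-1 : ℂ) ^ (m + 2 * μ * Multiset.card p.parts) *
      ((∏ j ∈ p.parts.toFinset, (Nat.factorial (Multiset.count j p.parts) : ℂ))⁻¹ *
        ∏ j ∈ p.parts.toFinset,
          (γ (2 * μ + j) / (Nat.factorial (2 * μ + j) : ℂ)) ^ Multiset.count j p.parts) *
      iteratedDeriv (m + 2 * μ * Multiset.card p.parts) H x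


noncomputable def qco (r : ℕ → ℂ) (s : ℂ) (m : ℕ) : ℂ :=
  ∑ p : Nat.Partition m,
    (∏ j ∈ p.parts.toFinset, (Nat.factorial (Multiset.count j p.parts) : ℂ))⁻¹ *
      ∏ j ∈ p.parts.toFinset, (s * r j) ^ Multiset.count j p.parts

open scoped PowerSeries.WithPiTopology in
noncomputable def EEser (r : ℕ → ℂ) (s : ℂ) (i : ℕ) : PowerSeries ℂ :=
  1 + ∑' j, ((s * r (i+1)) ^ (j+1) / (Nat.factorial (j+1) : ℂ)) • (PowerSeries.X : PowerSeries ℂ) ^ ((i+1) * (j+1))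

open scoped PowerSeries.WithPiTopology in
lemma hasProd_EEser (r : ℕ → ℂ) (s : ℂ) :
    HasProd (EEser r s) (Nat.Partition.genFun (fun i c => (s * r i) ^ c / (Nat.factorial c : ℂ))) := by
  have h := Nat.Partition.hasProd_genFun (fun i c => (s * r i) ^ c / (Nat.factorial c : ℂ))
  have e : EEser r s = fun i => 1 + ∑' j, ((s * r (i+1)) ^ (j+1) / (Nat.factorial (j+1) : ℂ)) •
      (PowerSeries.X : PowerSeries ℂ) ^ ((i+1) * (j+1)) := by
    funext i; rfl
  rw [e]
  exact h

lemma coeff_genFun_qco (r : ℕ → ℂ) (s : ℂ) (m : ℕ) :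
    (Nat.Partition.genFun (fun i c => (s * r i) ^ c / (Nat.factorial c : ℂ))).coeff m = qco r s m := by
  rw [Nat.Partition.coeff_genFun, qco]
  refine Finset.sum_congr rfl fun p _ => ?_
  simp only [Finsupp.prod, Multiset.toFinsupp_support, Multiset.toFinsupp_apply, div_eq_mul_inv]
  rw [Finset.prod_mul_distrib, Finset.prod_inv_distrib, mul_comm]

open scoped PowerSeries.WithPiTopology in
lemma coeff_EEser (r : ℕ → ℂ) (s : ℂ) (i d : ℕ) :
    (EEser r s i).coeff d = if (i+1) ∣ d then (s * r (i+1)) ^ (d/(i+1)) / (Nat.factorial (d/(i+1)) : ℂ) else 0 := by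
  have h := Nat.Partition.summable_genFun_term (fun i c => (s * r i) ^ c / (Nat.factorial c : ℂ)) i
  rw [EEser, map_add, h.map_tsum _ (PowerSeries.WithPiTopology.continuous_coeff _ _)]
  simp only [map_smul, PowerSeries.coeff_X_pow, PowerSeries.coeff_one]
  split_ifs with h1 h2 h2
  · subst h1
    simp
  · subst h1; simp at h2
  · obtain ⟨e, rfl⟩ := h2
    have he : e ≠ 0 := by rintro rfl; simp at h1
    obtain ⟨e, rfl⟩ := Nat.exists_eq_succ_of_ne_zero he
    rw [tsum_eq_single e]
    · simp
    · intro b hb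
      have : (i+1)*(e+1) ≠ (i+1)*(b+1) := by
        intro h; apply hb
        have := Nat.eq_of_mul_eq_mul_left (Nat.succ_pos i) h
        omega
      simp [this]
  · have : ∀ j, d ≠ (i+1)*(j+1) := fun j hj => h2 ⟨_, hj⟩
    simp [this]

lemma deriv_EEser (r : ℕ → ℂ) (s : ℂ) (i : ℕ) :
    PowerSeries.derivative ℂ (EEser r s i) =
      (PowerSeries.C (s * r (i+1) * (i+1)) * PowerSeries.X ^ i) * EEser r s i := by
  ext d
  rw [PowerSeries.coeff_derivative, mul_assoc, PowerSeries.coeff_C_mul, PowerSeries.coeff_X_pow_mul',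
    coeff_EEser, coeff_EEser]
  by_cases hd : i ≤ d
  · obtain ⟨e, rfl⟩ := Nat.exists_eq_add_of_le hd
    have h1 : i + e + 1 = (i+1) + e := by ring
    simp only [hd, if_true, add_tsub_cancel_left]
    rw [h1]
    by_cases h2 : (i+1) ∣ e
    · obtain ⟨f, rfl⟩ := h2
      rw [if_pos ⟨f+1, by ring⟩, if_pos ⟨f, rfl⟩]
      have h3 : ((i+1) + (i+1)*f)/(i+1) = f+1 := by
        rw [show (i+1) + (i+1)*f = (i+1)*(f+1) by ring]; simp
      rw [h3, Nat.mul_div_cancel_left _ (Nat.succ_pos i), Nat.factorial_succ, pow_succ]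
      have : (Nat.factorial f : ℂ) ≠ 0 := by exact_mod_cast Nat.factorial_ne_zero f
      have : (f:ℂ) + 1 ≠ 0 := by exact_mod_cast Nat.succ_ne_zero f
      push_cast
      field_simp
      ring
    · rw [if_neg h2, if_neg]
      · simp
      · intro h; exact h2 ((Nat.dvd_add_right (dvd_refl _)).1 h)
  · have : ¬ (i+1 ∣ d+1) := by
      intro h; have := Nat.le_of_dvd (by omega) h; omega
    simp [this, hd]

lemma deriv_prod_EEser (r : ℕ → ℂ) (s : ℂ) (N : ℕ) :
    PowerSeries.derivative ℂ (∏ i ∈ Finset.range N, EEser r s i) =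
      (∑ i ∈ Finset.range N, PowerSeries.C (s * r (i+1) * (i+1)) * PowerSeries.X ^ i) *
        ∏ i ∈ Finset.range N, EEser r s i := by
  induction N with
  | zero => simp
  | succ N ih =>
    rw [Finset.prod_range_succ, Finset.sum_range_succ, Derivation.leibniz, ih, deriv_EEser]
    simp only [smul_eq_mul]
    ring

open scoped PowerSeries.WithPiTopology in
lemma qco_rec (r : ℕ → ℂ) (s : ℂ) (m : ℕ) :
    qco r s (m+1) * (m+1) = ∑ i ∈ Finset.range (m+1), s * r (i+1) * (i+1) * qco r s (m-i) := by
  have hp := (hasProd_EEser r s).tendsto_prod_nat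
  rw [PowerSeries.WithPiTopology.tendsto_iff_coeff_tendsto] at hp
  simp only [coeff_genFun_qco] at hp
  have h1 := (hp (m+1)).mul_const ((m:ℂ)+1)
  have h2 : Filter.Tendsto (fun N => ∑ i ∈ Finset.range (m+1), s * r (i+1) * (i+1) *
      (PowerSeries.coeff (m-i)) (∏ i ∈ Finset.range N, EEser r s i)) Filter.atTop
      (nhds (∑ i ∈ Finset.range (m+1), s * r (i+1) * (i+1) * qco r s (m-i))) :=
    tendsto_finsetSum _ fun i _ => (hp (m-i)).const_mul _
  refine tendsto_nhds_unique h1 (h2.congr' ?_)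
  filter_upwards [Filter.eventually_ge_atTop (m+1)] with N hN
  rw [← PowerSeries.coeff_derivative, deriv_prod_EEser, PowerSeries.coeff_mul,
    Finset.Nat.sum_antidiagonal_eq_sum_range_succ_mk]
  refine Finset.sum_congr rfl fun i hi => ?_
  congr 1
  have : i < N := by have := Finset.mem_range.1 hi; omega
  simp [PowerSeries.coeff_X_pow, Finset.sum_ite_eq, this, -map_mul, PowerSeries.coeff_C_mul]

lemma qco_zero (r : ℕ → ℂ) (s : ℂ) : qco r s 0 = 1 := by
  simp [qco]


lemma coeff_of_hasSum (r : ℕ → ℂ) (ρ : ℝ) (hρ : 0 < ρ) (R : ℂ → ℂ)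
    (hR : ∀ w : ℂ, ‖w‖ < ρ → HasSum (fun j => r j * w ^ j) (R w)) :
    AnalyticAt ℂ R 0 ∧ ∀ n, iteratedDeriv n R 0 = Nat.factorial n * r n := by
  have h : HasFPowerSeriesAt R (FormalMultilinearSeries.ofScalars ℂ r) 0 := by
    rw [hasFPowerSeriesAt_iff]
    filter_upwards [Metric.ball_mem_nhds (0:ℂ) hρ] with z hz
    have := hR z (by simpa using hz)
    simpa [FormalMultilinearSeries.coeff_ofScalars, mul_comm] using this
  refine ⟨h.analyticAt, fun n => ?_⟩
  have h2 := h.analyticAt.hasFPowerSeriesAt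
  have h3 := congrArg (fun p => FormalMultilinearSeries.coeff p n) (h.eq_formalMultilinearSeries h2)
  simp only [FormalMultilinearSeries.coeff_ofScalars] at h3
  rw [h3]
  have : (Nat.factorial n : ℂ) ≠ 0 := by exact_mod_cast Nat.factorial_ne_zero n
  field_simp

lemma exp_coeff (r : ℕ → ℂ) (hr : r 0 = 0) (ρ : ℝ) (hρ : 0 < ρ) (R : ℂ → ℂ)
    (hR : ∀ w : ℂ, ‖w‖ < ρ → HasSum (fun j => r j * w ^ j) (R w)) (s : ℂ) (m : ℕ) :
    iteratedDeriv m (fun w => Complex.exp (s * R w)) 0 = Nat.factorial m * qco r s m := by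
  obtain ⟨han, hco⟩ := coeff_of_hasSum r ρ hρ R hR
  have hG : AnalyticAt ℂ (fun w => Complex.exp (s * R w)) 0 := (analyticAt_const.mul han).cexp
  have hR0 : R 0 = 0 := by simpa [hr] using hco 0
  induction m using Nat.strong_induction_on with
  | _ m ih =>
    rcases m with _ | m
    · simp [hR0, qco_zero]
    · rw [iteratedDeriv_succ']
      have e : deriv (fun w => Complex.exp (s * R w)) =ᶠ[nhds 0]
          (fun w => s * deriv R w) * (fun w => Complex.exp (s * R w)) := by
        filter_upwards [han.eventually_analyticAt] with w hw
        have := ((hw.differentiableAt.hasDerivAt.const_mul s).cexp).deriv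
        simp only [Pi.mul_apply]
        rw [this]; ring
      have hc1 : ContDiffAt ℂ (m : ℕ) (fun w => s * deriv R w) 0 :=
        (analyticAt_const.mul han.deriv).contDiffAt
      rw [e.iteratedDeriv_eq, iteratedDeriv_mul hc1 hG.contDiffAt]
      have hq := qco_rec r s m
      have hm : ((Nat.factorial (m+1) : ℕ) : ℂ) * qco r s (m+1)
          = Nat.factorial m * (qco r s (m+1) * (m+1)) := by
        rw [Nat.factorial_succ]; push_cast; ring
      rw [hm, hq, Finset.mul_sum]
      refine Finset.sum_congr rfl fun i hi => ?_
      have hi' : i ≤ m := by have := Finset.mem_range.1 hi; omega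
      rw [ih (m-i) (by omega)]
      have h1 : iteratedDeriv i (fun w => s * deriv R w) 0 = s * (Nat.factorial (i+1) * r (i+1)) := by
        rw [iteratedDeriv_const_mul_field, ← iteratedDeriv_succ', hco]
      rw [h1, ← Nat.choose_mul_factorial_mul_factorial hi', Nat.factorial_succ]
      push_cast; ring

lemma taylor_rem (G : ℂ → ℂ) (ρ ρ0 : ℝ) (h0 : 0 < ρ0) (h1 : ρ0 < ρ)
    (hG : DifferentiableOn ℂ G (Metric.ball 0 ρ)) (A : ℝ) (hA : ∀ w, ‖w‖ = ρ0 → ‖G w‖ ≤ A)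
    (w : ℂ) (hw : ‖w‖ ≤ ρ0 / 2) (N : ℕ) :
    ‖G w - ∑ m ∈ Finset.range N, (Nat.factorial m : ℂ)⁻¹ * iteratedDeriv m G 0 * w ^ m‖ ≤
      2 * A * (‖w‖ / ρ0) ^ N := by
  have hs := Complex.hasSum_taylorSeries_on_ball hG (z := w) (by simp; linarith)
  have hb : ∀ m, ‖(Nat.factorial m : ℂ)⁻¹ * iteratedDeriv m G 0 * w ^ m‖ ≤ A * (‖w‖ / ρ0) ^ m := by
    intro m
    have h2 := Complex.norm_iteratedDeriv_le_of_forall_mem_sphere_norm_le (f := G) (c := 0) (C := A) m h0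
      ((hG.mono (Metric.closedBall_subset_ball h1)).diffContOnCl_ball subset_rfl) (by
        intro z hz; exact hA z (by simpa using hz))
    have hf : (0:ℝ) < Nat.factorial m := by exact_mod_cast Nat.factorial_pos m
    rw [norm_mul, norm_mul, norm_inv, norm_pow, Complex.norm_natCast, div_pow]
    calc _ ≤ (Nat.factorial m : ℝ)⁻¹ * (Nat.factorial m * A / ρ0 ^ m) * ‖w‖ ^ m := by gcongr
      _ = _ := by field_simp
  have hA0 : 0 ≤ A := le_trans (norm_nonneg _) (hA (ρ0 : ℂ) (by simp [abs_of_pos h0]))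
  have hs' : HasSum (fun m => (Nat.factorial m : ℂ)⁻¹ * iteratedDeriv m G 0 * w ^ m) (G w) := by
    refine hs.congr_fun ?_ 
    intro m; simp; ring
  have hs2 := (hasSum_nat_add_iff' N).2 hs'
  have hx : ‖w‖ / ρ0 ≤ 1 / 2 := by rw [div_le_div_iff₀ h0 (by norm_num)]; linarith
  have hx0 : 0 ≤ ‖w‖ / ρ0 := by positivity
  have hg : HasSum (fun m : ℕ => A * (‖w‖ / ρ0) ^ N * (1/2:ℝ)^m) (A * (‖w‖ / ρ0) ^ N * 2) := by
    exact hasSum_geometric_two.mul_left _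
  have := hs2.norm_le_of_bounded hg (fun m => (hb (m+N)).trans (by
    rw [pow_add, mul_comm ((‖w‖ / ρ0)^m), ← mul_assoc]
    gcongr))
  linarith

lemma exp_expansion (r : ℕ → ℂ) (hr : r 0 = 0) (ρ : ℝ) (hρ : 0 < ρ) (R : ℂ → ℂ)
    (hR : ∀ w : ℂ, ‖w‖ < ρ → HasSum (fun j => r j * w ^ j) (R w)) (θ : ℝ) (hθ : 0 < θ) :
    ∃ ρ0 : ℝ, 0 < ρ0 ∧ ρ0 < ρ ∧ DifferentiableOn ℂ R (Metric.ball 0 ρ0) ∧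
      ∀ (N : ℕ) (s w : ℂ), ‖w‖ ≤ ρ0 / 2 →
        ‖Complex.exp (s * R w) - ∑ m ∈ Finset.range N, qco r s m * w ^ m‖ ≤
          2 * Real.exp (θ * ‖s‖) * (‖w‖ / ρ0) ^ N := by
  obtain ⟨han, hco⟩ := coeff_of_hasSum r ρ hρ R hR
  have hR0 : R 0 = 0 := by simpa [hr] using hco 0
  have h1 : ∀ᶠ w in nhds (0:ℂ), ‖R w‖ < θ := by
    have := han.continuousAt.norm
    exact this.eventually_lt continuousAt_const (by simpa [hR0] using hθ)
  obtain ⟨ρ1, hρ1, hb⟩ := Metric.eventually_nhds_iff.1 (h1.and han.eventually_analyticAt)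
  have hd : DifferentiableOn ℂ R (Metric.ball 0 ρ1) := fun w hw =>
    (hb hw).2.differentiableAt.differentiableWithinAt
  refine ⟨min ρ1 ρ / 2, by positivity, ?_, ?_, ?_⟩
  · have := min_le_right ρ1 ρ; linarith
  · refine hd.mono (Metric.ball_subset_ball ?_)
    have := min_le_left ρ1 ρ
    have : 0 < min ρ1 ρ := by positivity
    linarith
  · intro N s w hw
    have hm := min_le_left ρ1 ρ
    have hm0 : 0 < min ρ1 ρ := by positivity
    have := taylor_rem (fun w => Complex.exp (s * R w)) ρ1 (min ρ1 ρ / 2) (by positivity) (by linarith)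
      ((hd.const_mul s).cexp) (Real.exp (θ * ‖s‖)) (by
        intro w hw
        rw [Complex.norm_exp]
        apply Real.exp_le_exp.2
        calc (s * R w).re ≤ ‖s * R w‖ := Complex.re_le_norm _
          _ = ‖R w‖ * ‖s‖ := by rw [norm_mul, mul_comm]
          _ ≤ θ * ‖s‖ := by
            gcongr
            exact (hb (show dist w 0 < ρ1 by simp [hw]; linarith)).1.le) w hw N
    convert this using 5 with m hm
    rw [exp_coeff r hr ρ hρ R hR]
    have : (Nat.factorial m : ℂ) ≠ 0 := by exact_mod_cast Nat.factorial_ne_zero m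
    field_simp

lemma pow_add_sub_le (x h : ℂ) (p : ℕ) :
    ‖(x + h) ^ p - x ^ p‖ ≤ (‖x‖ + ‖h‖) ^ p - ‖x‖ ^ p := by
  induction p with
  | zero => simp
  | succ p ih =>
    have e : (x + h) ^ (p+1) - x ^ (p+1) = (x + h) * ((x+h)^p - x^p) + h * x ^ p := by ring
    rw [e]
    calc _ ≤ ‖x + h‖ * ‖(x+h)^p - x^p‖ + ‖h‖ * ‖x‖ ^ p := by
            refine (norm_add_le _ _).trans ?_
            rw [norm_mul, norm_mul, norm_pow]
      _ ≤ (‖x‖ + ‖h‖) * ((‖x‖ + ‖h‖) ^ p - ‖x‖ ^ p) + ‖h‖ * ‖x‖ ^ p := by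
            gcongr; exact norm_add_le _ _
      _ = _ := by ring

lemma pow_diff_bound (p : ℕ) (ε : ℝ) (hε : 0 < ε) :
    ∃ B : ℝ, 0 < B ∧ ∀ ξ η : ℝ,
      ‖((ξ : ℂ) + η * I) ^ p - (ξ : ℂ) ^ p‖ ≤ ε * |ξ| ^ p + B * |η| ^ p := by
  have hc : ContinuousAt (fun t : ℝ => (1 + t) ^ p - 1) 0 := by fun_prop
  have h1 : ∀ᶠ t in nhds (0:ℝ), (1 + t) ^ p - 1 < ε :=
    hc.eventually_lt continuousAt_const (by simpa using hε)
  obtain ⟨d, hd, hb⟩ := Metric.eventually_nhds_iff.1 h1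
  have hκ := hb (y := d/2) (by simp [abs_of_pos hd]; linarith)
  set κ := d / 2 with hκdef
  have hκ0 : 0 < κ := by positivity
  refine ⟨(1 / κ + 1) ^ p, by positivity, fun ξ η => ?_⟩
  have h2 := pow_add_sub_le (ξ : ℂ) (η * I) p
  have hn : ‖(η : ℂ) * I‖ = |η| := by simp
  rw [hn, Complex.norm_real, Real.norm_eq_abs] at h2
  have a1 := abs_nonneg ξ
  have a2 := abs_nonneg η
  refine h2.trans ?_
  rcases le_total |η| (κ * |ξ|) with h | h
  · have : (|ξ| + |η|) ^ p ≤ ((1 + κ) * |ξ|) ^ p := by gcongr; linarith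
    rw [mul_pow] at this
    have h3 : 0 ≤ |ξ| ^ p := by positivity
    have h4 : 0 ≤ (1 / κ + 1) ^ p * |η| ^ p := by positivity
    nlinarith
  · have h5 : |ξ| ≤ 1 / κ * |η| := by
      rw [div_mul_eq_mul_div, one_mul, le_div_iff₀ hκ0]; linarith
    have : (|ξ| + |η|) ^ p ≤ ((1/κ + 1) * |η|) ^ p := by gcongr; linarith
    rw [mul_pow] at this
    have h3 : 0 ≤ |ξ| ^ p := by positivity
    have h4 : 0 ≤ ε * |ξ| ^ p := by positivity
    linarith

lemma pow_le_exp_bound (N p : ℕ) (hp : 1 ≤ p) (θ : ℝ) (hθ : 0 < θ) :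
    ∃ C : ℝ, 0 < C ∧ ∀ u : ℝ, 0 ≤ u → u ^ N ≤ C * Real.exp (θ * u ^ p) := by
  refine ⟨Nat.factorial N / θ ^ N * Real.exp θ, by positivity, fun u hu => ?_⟩
  have h1 : u ≤ 1 + u ^ p := by
    rcases le_total u 1 with h | h
    · have : 0 ≤ u ^ p := by positivity
      linarith
    · have := le_self_pow₀ h (by omega : p ≠ 0)
      linarith
  have h2 := Real.pow_div_factorial_le_exp (θ * (1 + u ^ p)) (by positivity) N
  have hf : (0:ℝ) < Nat.factorial N := by exact_mod_cast Nat.factorial_pos N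
  rw [div_le_iff₀ hf, mul_pow, mul_add, Real.exp_add, mul_one] at h2
  calc u ^ N ≤ (1 + u ^ p) ^ N := by gcongr
    _ = θ ^ N * (1 + u ^ p) ^ N / θ ^ N := by field_simp
    _ ≤ (Real.exp θ * Real.exp (θ * u ^ p) * Nat.factorial N) / θ ^ N := by gcongr
    _ = _ := by ring

lemma kernel_bound (μ : ℕ) (β : ℂ) (hβ : 0 < β.re) :
    ∃ θ : ℝ, 0 < θ ∧ ∃ B : ℝ, 0 < B ∧ ∀ ξ η : ℝ,
      (-β * ((ξ : ℂ) + η * I) ^ (2 * μ)).re + 2 * θ * ‖(ξ : ℂ) + η * I‖ ^ (2 * μ) ≤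
        -(β.re / 2) * |ξ| ^ (2 * μ) + B * |η| ^ (2 * μ) := by
  have hβn : 0 < ‖β‖ := lt_of_lt_of_le hβ (Complex.re_le_norm β)
  obtain ⟨B0, hB0, hB⟩ := pow_diff_bound (2 * μ) (min 1 (β.re / (4 * ‖β‖))) (by positivity)
  refine ⟨β.re / 16, by positivity, (‖β‖ + β.re / 8) * B0, by positivity, fun ξ η => ?_⟩
  have h := hB ξ η
  set z : ℂ := (ξ : ℂ) + η * I
  have hX : 0 ≤ |ξ| ^ (2 * μ) := by positivity
  have hY : 0 ≤ |η| ^ (2 * μ) := by positivity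
  have e1 : ((ξ : ℂ) ^ (2 * μ)) = ((|ξ| ^ (2 * μ) : ℝ) : ℂ) := by
    rw [pow_mul |ξ|, sq_abs, ← pow_mul]; push_cast; rfl
  have e2 : (-β * z ^ (2 * μ)).re = -β.re * |ξ| ^ (2 * μ) + (-β * (z ^ (2*μ) - (ξ:ℂ) ^ (2*μ))).re := by
    rw [e1, mul_sub, Complex.sub_re, Complex.re_mul_ofReal, Complex.neg_re]
    ring
  have h3 : (-β * (z ^ (2*μ) - (ξ:ℂ) ^ (2*μ))).re ≤ ‖β‖ * ‖z ^ (2*μ) - (ξ:ℂ) ^ (2*μ)‖ := by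
    refine (Complex.re_le_norm _).trans ?_
    rw [norm_mul, norm_neg]
  have h4 : ‖z‖ ^ (2 * μ) ≤ |ξ| ^ (2*μ) + ‖z ^ (2*μ) - (ξ:ℂ) ^ (2*μ)‖ := by
    have : z ^ (2*μ) = (ξ:ℂ) ^ (2*μ) + (z ^ (2*μ) - (ξ:ℂ) ^ (2*μ)) := by ring
    rw [← norm_pow]
    calc ‖z ^ (2*μ)‖ = ‖(ξ:ℂ) ^ (2*μ) + (z ^ (2*μ) - (ξ:ℂ) ^ (2*μ))‖ := by rw [← this]
      _ ≤ ‖(ξ:ℂ) ^ (2*μ)‖ + ‖(z ^ (2*μ) - (ξ:ℂ) ^ (2*μ))‖ := norm_add_le _ _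
      _ = _ := by rw [norm_pow, Complex.norm_real, Real.norm_eq_abs]
  set D := ‖z ^ (2*μ) - (ξ:ℂ) ^ (2*μ)‖
  have m1 : min 1 (β.re / (4 * ‖β‖)) * |ξ| ^ (2*μ) ≤ 1 * |ξ| ^ (2*μ) :=
    mul_le_mul_of_nonneg_right (min_le_left _ _) hX
  have m2 : ‖β‖ * (min 1 (β.re / (4 * ‖β‖)) * |ξ| ^ (2*μ)) ≤ β.re / 4 * |ξ| ^ (2*μ) := by
    calc _ ≤ ‖β‖ * ((β.re / (4 * ‖β‖)) * |ξ| ^ (2*μ)) := by gcongr; exact min_le_right _ _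
      _ = _ := by field_simp
  have m3 : ‖β‖ * D ≤ β.re / 4 * |ξ| ^ (2*μ) + ‖β‖ * (B0 * |η| ^ (2*μ)) := by
    calc _ ≤ ‖β‖ * (min 1 (β.re / (4 * ‖β‖)) * |ξ| ^ (2*μ) + B0 * |η| ^ (2*μ)) := by gcongr
      _ ≤ _ := by rw [mul_add]; linarith
  have m4 : ‖z‖ ^ (2*μ) ≤ 2 * |ξ| ^ (2*μ) + B0 * |η| ^ (2*μ) := by linarith
  have m5 : β.re / 8 * ‖z‖ ^ (2*μ) ≤ β.re / 8 * (2 * |ξ| ^ (2*μ) + B0 * |η| ^ (2*μ)) := by gcongr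
  rw [e2]
  nlinarith

open MeasureTheory in
lemma integrable_exp_neg_pow (p : ℕ) (hp : 1 ≤ p) (b : ℝ) (hb : 0 < b) :
    Integrable (fun x : ℝ => Real.exp (-b * |x| ^ p)) := by
  obtain ⟨C0, hC0, h0⟩ := pow_le_exp_bound 0 p hp b hb
  obtain ⟨C, hC, h⟩ := pow_le_exp_bound 2 p hp b hb
  refine (integrable_inv_one_add_sq.const_mul (C0 + C)).mono' (by fun_prop) (ae_of_all _ fun x => ?_)
  have h1 := h |x| (abs_nonneg x)
  have h2 := h0 |x| (abs_nonneg x)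
  rw [Real.norm_of_nonneg (Real.exp_pos _).le, neg_mul, Real.exp_neg, ← div_eq_mul_inv,
    inv_eq_one_div, div_le_div_iff₀ (Real.exp_pos _) (by positivity)]
  rw [sq_abs] at h1
  rw [pow_zero] at h2
  linarith

open MeasureTheory in
lemma scaled_integral_le (p : ℕ) (hp : 1 ≤ p) (b : ℝ) (hb : 0 < b) :
    ∃ J : ℝ, 0 < J ∧ ∀ n : ℕ, 1 ≤ n → ∀ δ : ℝ, 0 < δ →
      ∫ x in (-δ)..δ, Real.exp (-(n * b * |x| ^ p)) ≤ J * (n : ℝ) ^ (-(1:ℝ) / p) := by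
  have hi := integrable_exp_neg_pow p hp b hb
  have hJ0 : 0 ≤ ∫ x : ℝ, Real.exp (-b * |x| ^ p) := integral_nonneg fun x => (Real.exp_pos _).le
  refine ⟨(∫ x : ℝ, Real.exp (-b * |x| ^ p)) + 1, by linarith, fun n hn δ hδ => ?_⟩
  have hn0 : (0:ℝ) < n := by exact_mod_cast hn
  set a : ℝ := (n : ℝ) ^ ((1:ℝ) / p) with ha
  have ha0 : 0 < a := by positivity
  have hap : a ^ p = n := by
    rw [ha, one_div, Real.rpow_inv_natCast_pow hn0.le (by omega)]
  have e : (fun x : ℝ => Real.exp (-(n * b * |x| ^ p))) = fun x => Real.exp (-b * |a * x| ^ p) := by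
    funext x
    rw [abs_mul, abs_of_pos ha0, mul_pow, hap]; ring_nf
  have hai : (n : ℝ) ^ (-(1:ℝ) / p) = a⁻¹ := by
    rw [ha, neg_div, Real.rpow_neg hn0.le]
  have hitg : Integrable (fun x : ℝ => Real.exp (-b * |a * x| ^ p)) :=
    hi.comp_mul_left' ha0.ne'
  rw [intervalIntegral.integral_of_le (by linarith), e, hai]
  calc _ ≤ ∫ x : ℝ, Real.exp (-b * |a * x| ^ p) :=
        setIntegral_le_integral hitg (ae_of_all _ fun x => (Real.exp_pos _).le)
    _ = a⁻¹ * ∫ x : ℝ, Real.exp (-b * |x| ^ p) := by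
        rw [Measure.integral_comp_mul_left (fun x => Real.exp (-b * |x| ^ p)) a,
          abs_of_pos (inv_pos.2 ha0), smul_eq_mul]
    _ ≤ _ := by
        have := inv_pos.2 ha0
        nlinarith

open MeasureTheory in
lemma integrable_Hterm (μ : ℕ) (hμ : 1 ≤ μ) (β : ℂ) (hβ : 0 < β.re) (j : ℕ) (x : ℝ) :
    Integrable (fun θ : ℝ => (-I * θ) ^ j * (Complex.exp (-I * x * θ) * Complex.exp (-β * (θ : ℂ) ^ (2 * μ)))) := by
  obtain ⟨C, hC, h⟩ := pow_le_exp_bound j (2*μ) (by omega) (β.re/2) (by positivity)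
  refine ((integrable_exp_neg_pow (2*μ) (by omega) (β.re/2) (by positivity)).const_mul C).mono'
    (by fun_prop) (ae_of_all _ fun θ => ?_)
  have h1 := h |θ| (abs_nonneg θ)
  have e1 : ((θ : ℂ) ^ (2 * μ)) = ((|θ| ^ (2 * μ) : ℝ) : ℂ) := by
    rw [pow_mul |θ|, sq_abs, ← pow_mul]; push_cast; rfl
  rw [norm_mul, norm_mul, norm_pow, norm_mul, Complex.norm_exp, Complex.norm_exp, e1]
  have e2 : (-I * (x:ℂ) * θ).re = 0 := by simp
  have e3 : (-β * ((|θ| ^ (2 * μ) : ℝ) : ℂ)).re = -β.re * |θ| ^ (2*μ) := by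
    rw [Complex.re_mul_ofReal, Complex.neg_re]
  rw [e2, e3]
  simp only [norm_neg, Complex.norm_I, one_mul, Complex.norm_real, Real.norm_eq_abs, Real.exp_zero]
  calc _ ≤ C * Real.exp (β.re/2 * |θ| ^ (2*μ)) * Real.exp (-β.re * |θ| ^ (2*μ)) := by gcongr
    _ = _ := by rw [mul_assoc, ← Real.exp_add]; ring_nf

open MeasureTheory in
lemma iteratedDeriv_Hfun (μ : ℕ) (hμ : 1 ≤ μ) (β : ℂ) (hβ : 0 < β.re) (j : ℕ) (x : ℝ) :
    iteratedDeriv j (Hfun μ β) x = (1 / (2 * Real.pi : ℂ)) *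
      ∫ θ : ℝ, (-I * θ) ^ j * (Complex.exp (-I * x * θ) * Complex.exp (-β * (θ : ℂ) ^ (2 * μ))) := by
  induction j generalizing x with
  | zero => simp [Hfun]
  | succ j ih =>
    rw [iteratedDeriv_succ, funext ih]
    apply HasDerivAt.deriv
    apply HasDerivAt.const_mul
    refine (hasDerivAt_integral_of_dominated_loc_of_deriv_le
      (F := fun (x : ℝ) (θ : ℝ) => (-I * θ) ^ j * (Complex.exp (-I * x * θ) * Complex.exp (-β * (θ : ℂ) ^ (2 * μ))))
      (F' := fun (x : ℝ) (θ : ℝ) => (-I * θ) ^ (j+1) * (Complex.exp (-I * x * θ) * Complex.exp (-β * (θ : ℂ) ^ (2 * μ))))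
      (bound := fun θ : ℝ => ‖(-I * θ) ^ (j+1) * (Complex.exp (-I * x * θ) * Complex.exp (-β * (θ : ℂ) ^ (2 * μ)))‖)
      (s := Set.univ) Filter.univ_mem ?_ ?_ ?_ ?_ ?_ ?_).2
    · exact Filter.Eventually.of_forall fun y => (integrable_Hterm μ hμ β hβ j y).aestronglyMeasurable
    · exact integrable_Hterm μ hμ β hβ j x
    · exact (integrable_Hterm μ hμ β hβ (j+1) x).aestronglyMeasurable
    · refine ae_of_all _ fun θ y _ => le_of_eq ?_
      have e2 : ∀ y : ℝ, (-I * (y:ℂ) * θ).re = 0 := by simp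
      simp only [norm_mul, Complex.norm_exp, e2]
    · exact (integrable_Hterm μ hμ β hβ (j+1) x).norm
    · refine ae_of_all _ fun θ y _ => ?_
      have h1 : HasDerivAt (fun y : ℝ => -I * (y:ℂ) * θ) (-I * 1 * θ) y :=
        ((Complex.ofRealCLM.hasDerivAt (x := y)).const_mul (-I)).mul_const _
      have := ((h1.cexp).mul_const (Complex.exp (-β * (θ : ℂ) ^ (2 * μ)))).const_mul ((-I * θ) ^ j)
      refine this.congr_deriv ?_
      rw [pow_succ]
      ring

noncomputable def rcoef (μ : ℕ) (γ : ℕ → ℂ) (j : ℕ) : ℂ :=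
  γ (2 * μ + j) / (Nat.factorial (2 * μ + j) : ℂ) * I ^ (2 * μ + j)

noncomputable def cpart (μ : ℕ) (γ : ℕ → ℂ) {m : ℕ} (p : Nat.Partition m) : ℂ :=
  ((∏ j ∈ p.parts.toFinset, (Nat.factorial (Multiset.count j p.parts) : ℂ))⁻¹ *
        ∏ j ∈ p.parts.toFinset,
          (γ (2 * μ + j) / (Nat.factorial (2 * μ + j) : ℂ)) ^ Multiset.count j p.parts)

lemma qco_rcoef (μ : ℕ) (γ : ℕ → ℂ) (s : ℂ) (m : ℕ) :
    qco (rcoef μ γ) s m = ∑ p : Nat.Partition m,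
      cpart μ γ p * (s ^ (Multiset.card p.parts) * I ^ (m + 2 * μ * Multiset.card p.parts)) := by
  refine Finset.sum_congr rfl fun p _ => ?_
  rw [cpart, mul_assoc]
  congr 1
  have h1 : ∑ j ∈ p.parts.toFinset, Multiset.count j p.parts = Multiset.card p.parts :=
    Multiset.toFinset_sum_count_eq _
  have h2 : ∑ j ∈ p.parts.toFinset, Multiset.count j p.parts * j = m := by
    have := Finset.sum_multiset_count p.parts
    rw [p.parts_sum] at this
    simpa using this.symm
  have h3 : ∑ j ∈ p.parts.toFinset, (2 * μ + j) * Multiset.count j p.parts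
      = m + 2 * μ * Multiset.card p.parts := by
    have h4 : ∑ j ∈ p.parts.toFinset, (2 * μ + j) * Multiset.count j p.parts =
        ∑ j ∈ p.parts.toFinset, (Multiset.count j p.parts * j + 2 * μ * Multiset.count j p.parts) :=
      Finset.sum_congr rfl fun j _ => by ring
    rw [h4, Finset.sum_add_distrib, h2, ← Finset.mul_sum, h1]
  rw [← h3, ← Finset.prod_pow_eq_pow_sum, ← h1, ← Finset.prod_pow_eq_pow_sum,
    ← Finset.prod_mul_distrib, ← Finset.prod_mul_distrib]
  refine Finset.prod_congr rfl fun j _ => ?_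
  rw [rcoef, pow_mul]
  ring

lemma PdiffH_eq (μ : ℕ) (γ : ℕ → ℂ) (m : ℕ) (H : ℝ → ℂ) (x : ℝ) :
    PdiffH μ γ m H x = ∑ p : Nat.Partition m,
      cpart μ γ p * ((-1 : ℂ) ^ (m + 2 * μ * Multiset.card p.parts) *
        iteratedDeriv (m + 2 * μ * Multiset.card p.parts) H x) := by
  refine Finset.sum_congr rfl fun p _ => ?_
  rw [cpart]; ring

lemma scale_facts (μ : ℕ) (hμ : 1 ≤ μ) (n : ℕ) (hn : 1 ≤ n) :
    0 < (n : ℝ) ^ ((1:ℝ) / (2 * (μ:ℝ))) ∧ 1 ≤ (n : ℝ) ^ ((1:ℝ) / (2 * (μ:ℝ))) ∧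
      ((n : ℝ) ^ ((1:ℝ) / (2 * (μ:ℝ)))) ^ (2 * μ) = n ∧
      ∀ m : ℕ, (n : ℝ) ^ (-((m:ℝ) + 1) / (2 * (μ:ℝ))) =
        (((n : ℝ) ^ ((1:ℝ) / (2 * (μ:ℝ)))) ^ (m + 1))⁻¹ := by
  have hn1 : (1:ℝ) ≤ n := by exact_mod_cast hn
  have hn0 : (0:ℝ) < n := by linarith
  have hm0 : (0:ℝ) < μ := by exact_mod_cast hμ
  refine ⟨by positivity, Real.one_le_rpow hn1 (by positivity), ?_, fun m => ?_⟩
  · rw [← Real.rpow_natCast, ← Real.rpow_mul hn0.le]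
    push_cast
    rw [one_div_mul_cancel (by positivity), Real.rpow_one]
  · rw [← Real.rpow_natCast, ← Real.rpow_mul hn0.le, ← Real.rpow_neg hn0.le]
    congr 1
    push_cast
    ring

open MeasureTheory in
lemma term_eq (μ : ℕ) (hμ : 1 ≤ μ) (β : ℂ) (hβ : 0 < β.re) (n : ℕ) (hn : 1 ≤ n) (y : ℝ) (m k : ℕ) :
    Integrable (fun ξ : ℝ => Complex.exp (-I * y * ξ) * Complex.exp (-(n * β * (ξ:ℂ) ^ (2 * μ))) *
        (((n * (ξ:ℂ) ^ (2 * μ)) ^ k * I ^ (m + 2 * μ * k)) * (ξ:ℂ) ^ m)) ∧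
    (((n : ℝ) ^ (-((m : ℝ) + 1) / (2 * (μ : ℝ))) : ℝ) : ℂ) *
      ((-1 : ℂ) ^ (m + 2 * μ * k) * iteratedDeriv (m + 2 * μ * k) (Hfun μ β)
        (y / (n : ℝ) ^ ((1 : ℝ) / (2 * (μ : ℝ))))) =
      (1 / (2 * Real.pi : ℂ)) * ∫ ξ : ℝ, Complex.exp (-I * y * ξ) *
        Complex.exp (-(n * β * (ξ:ℂ) ^ (2 * μ))) *
        (((n * (ξ:ℂ) ^ (2 * μ)) ^ k * I ^ (m + 2 * μ * k)) * (ξ:ℂ) ^ m) := by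
  obtain ⟨ha0, ha1, hap, hpow⟩ := scale_facts μ hμ n hn
  set a : ℝ := (n : ℝ) ^ ((1:ℝ) / (2 * (μ:ℝ))) with ha
  have hap' : (a : ℂ) ^ (2 * μ) = n := by rw [← Complex.ofReal_pow, hap]; simp
  have haC : (a : ℂ) ≠ 0 := by exact_mod_cast ha0.ne'
  set J := m + 2 * μ * k with hJ
  set g : ℝ → ℂ := fun θ => (-I * θ) ^ J * (Complex.exp (-I * ((y / a : ℝ) : ℂ) * θ) *
    Complex.exp (-β * (θ : ℂ) ^ (2 * μ))) with hg
  have hgi : Integrable g := integrable_Hterm μ hμ β hβ J (y / a)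
  have hga : ∀ ξ : ℝ, Complex.exp (-I * y * ξ) * Complex.exp (-(n * β * (ξ:ℂ) ^ (2 * μ))) *
        (((n * (ξ:ℂ) ^ (2 * μ)) ^ k * I ^ J) * (ξ:ℂ) ^ m) =
        ((-1) ^ J * ((a:ℂ) ^ m)⁻¹) * g (a * ξ) := by
    intro ξ
    simp only [hg]
    have e1 : -I * ((y / a : ℝ) : ℂ) * ((a * ξ : ℝ) : ℂ) = -I * y * ξ := by
      push_cast; field_simp
    have e2 : -β * ((a * ξ : ℝ) : ℂ) ^ (2 * μ) = -(n * β * (ξ:ℂ) ^ (2 * μ)) := by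
      push_cast; rw [mul_pow, hap']; ring
    have e3 : (-I * ((a * ξ : ℝ) : ℂ)) ^ J = (-1) ^ J * (I ^ J * (a:ℂ) ^ m * (n : ℂ) ^ k * (ξ:ℂ) ^ m * ((ξ:ℂ) ^ (2 * μ)) ^ k) := by
      rw [← hap', ← pow_mul, ← pow_mul]
      push_cast
      rw [show -I * ((a:ℂ) * ξ) = (-1) * (I * (a * ξ)) by ring, mul_pow, mul_pow I, mul_pow (a:ℂ), hJ,
        pow_add (a:ℂ), pow_add (ξ:ℂ)]
      ring
    rw [e1, e2, e3, mul_pow]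
    have : ((-1:ℂ) ^ J) * (-1) ^ J = 1 := by rw [← mul_pow]; simp
    have h2 : ((a:ℂ) ^ m)⁻¹ * (a:ℂ) ^ m = 1 := inv_mul_cancel₀ (pow_ne_zero _ haC)
    have h3 : ((-1:ℂ) ^ J) * (-1) ^ J * (((a:ℂ) ^ m)⁻¹ * (a:ℂ) ^ m) = 1 := by rw [this, h2, one_mul]
    linear_combination (-(Complex.exp (-I * y * ξ) * Complex.exp (-(n * β * (ξ:ℂ) ^ (2 * μ))) * ((n:ℂ) ^ k * ((ξ:ℂ) ^ (2 * μ)) ^ k * I ^ J * (ξ:ℂ) ^ m))) * h3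
  constructor
  · simp_rw [hga]
    exact (hgi.comp_mul_left' ha0.ne').const_mul _
  · simp_rw [hga]
    rw [iteratedDeriv_Hfun μ hμ β hβ, integral_const_mul, Measure.integral_comp_mul_left g a, hpow m,
      abs_of_pos (inv_pos.2 ha0)]
    simp only [Complex.real_smul]
    push_cast
    rw [pow_succ, mul_inv]
    simp only [hg]
    push_cast
    ring

/-- the polynomial-type main part -/
noncomputable def Qmain (μ : ℕ) (γ : ℕ → ℂ) (M : ℕ) (n : ℕ) (z : ℂ) : ℂ :=
  ∑ m ∈ Finset.range (M + 1), qco (rcoef μ γ) (n * z ^ (2 * μ)) m * z ^ m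

lemma Qmain_eq (μ : ℕ) (γ : ℕ → ℂ) (M : ℕ) (n : ℕ) (z : ℂ) :
    Qmain μ γ M n z = ∑ m ∈ Finset.range (M + 1), ∑ p : Nat.Partition m,
      cpart μ γ p * (((n * z ^ (2 * μ)) ^ (Multiset.card p.parts) *
        I ^ (m + 2 * μ * Multiset.card p.parts)) * z ^ m) := by
  refine Finset.sum_congr rfl fun m _ => ?_
  rw [qco_rcoef, Finset.sum_mul]
  exact Finset.sum_congr rfl fun p _ => by ring

open MeasureTheory in
lemma main_eq (μ : ℕ) (hμ : 1 ≤ μ) (β : ℂ) (hβ : 0 < β.re) (γ : ℕ → ℂ) (M : ℕ)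
    (n : ℕ) (hn : 1 ≤ n) (y : ℝ) :
    Integrable (fun ξ : ℝ => Complex.exp (-I * y * ξ) * Complex.exp (-(n * β * (ξ:ℂ) ^ (2 * μ))) *
        Qmain μ γ M n ξ) ∧
    ∑ m ∈ Finset.range (M + 1), (((n : ℝ) ^ (-((m : ℝ) + 1) / (2 * (μ : ℝ))) : ℝ) : ℂ) *
      PdiffH μ γ m (Hfun μ β) (y / (n : ℝ) ^ ((1 : ℝ) / (2 * (μ : ℝ)))) =
      (1 / (2 * Real.pi : ℂ)) * ∫ ξ : ℝ, Complex.exp (-I * y * ξ) *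
        Complex.exp (-(n * β * (ξ:ℂ) ^ (2 * μ))) * Qmain μ γ M n ξ := by
  have e : ∀ ξ : ℝ, Complex.exp (-I * y * ξ) * Complex.exp (-(n * β * (ξ:ℂ) ^ (2 * μ))) *
        Qmain μ γ M n ξ = ∑ m ∈ Finset.range (M + 1), ∑ p : Nat.Partition m,
      cpart μ γ p * (Complex.exp (-I * y * ξ) * Complex.exp (-(n * β * (ξ:ℂ) ^ (2 * μ))) *
        (((n * (ξ:ℂ) ^ (2 * μ)) ^ (Multiset.card p.parts) *
        I ^ (m + 2 * μ * Multiset.card p.parts)) * (ξ:ℂ) ^ m)) := by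
    intro ξ
    rw [Qmain_eq, Finset.mul_sum]
    refine Finset.sum_congr rfl fun m _ => ?_
    rw [Finset.mul_sum]
    exact Finset.sum_congr rfl fun p _ => by ring
  simp_rw [e]
  have hI := fun (m k : ℕ) => (term_eq μ hμ β hβ n hn y m k).1
  constructor
  · exact integrable_finsetSum _ fun m _ => integrable_finsetSum _ fun p _ => (hI m _).const_mul _
  · rw [integral_finsetSum _ fun m _ => integrable_finsetSum _ fun p _ => (hI m _).const_mul _,
      Finset.mul_sum]
    refine Finset.sum_congr rfl fun m _ => ?_
    rw [integral_finsetSum _ fun p _ => (hI m _).const_mul _, PdiffH_eq, Finset.mul_sum, Finset.mul_sum]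
    refine Finset.sum_congr rfl fun p _ => ?_
    rw [integral_const_mul, mul_left_comm, (term_eq μ hμ β hβ n hn y m _).2]
    ring

lemma Qmain_bound (μ : ℕ) (hμ : 1 ≤ μ) (γ : ℕ → ℂ) (M : ℕ) (b : ℝ) (hb : 0 < b) :
    ∃ C : ℝ, 0 < C ∧ ∀ n : ℕ, 1 ≤ n → ∀ ξ : ℝ,
      ‖Qmain μ γ M n ξ‖ ≤ C * Real.exp (b * (n * |ξ| ^ (2 * μ))) := by
  choose C hC h using fun N : ℕ => pow_le_exp_bound N (2 * μ) (by omega) b hb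
  refine ⟨1 + ∑ m ∈ Finset.range (M + 1), ∑ p : Nat.Partition m,
    ‖cpart μ γ p‖ * C (m + 2 * μ * Multiset.card p.parts), ?_, fun n hn ξ => ?_⟩
  · have : 0 ≤ ∑ m ∈ Finset.range (M + 1), ∑ p : Nat.Partition m,
      ‖cpart μ γ p‖ * C (m + 2 * μ * Multiset.card p.parts) :=
      Finset.sum_nonneg fun m _ => Finset.sum_nonneg fun p _ => mul_nonneg (norm_nonneg _) (hC _).le
    linarith
  · obtain ⟨ha0, ha1, hap, -⟩ := scale_facts μ hμ n hn
    set a : ℝ := (n : ℝ) ^ ((1:ℝ) / (2 * (μ:ℝ))) with ha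
    rw [Qmain_eq, add_mul, one_mul, Finset.sum_mul]
    refine le_add_of_nonneg_of_le (Real.exp_pos _).le
      ((norm_sum_le _ _).trans (Finset.sum_le_sum fun m _ => ?_))
    rw [Finset.sum_mul]
    refine (norm_sum_le _ _).trans (Finset.sum_le_sum fun p _ => ?_)
    set k := Multiset.card p.parts
    have h1 := h (m + 2 * μ * k) (a * |ξ|) (by positivity)
    rw [mul_pow a |ξ| (2 * μ), hap] at h1
    rw [norm_mul, mul_assoc ‖cpart μ γ p‖]
    refine mul_le_mul_of_nonneg_left (le_trans ?_ h1) (norm_nonneg (cpart μ γ p))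
    rw [norm_mul, norm_mul, norm_pow, norm_pow, norm_pow, norm_mul, norm_pow, Complex.norm_I,
      Complex.norm_natCast, Complex.norm_real, Real.norm_eq_abs, one_pow, mul_one]
    calc (n * |ξ| ^ (2 * μ)) ^ k * |ξ| ^ m = a ^ (2 * μ * k) * |ξ| ^ (m + 2 * μ * k) := by
          rw [← hap]; ring
      _ ≤ a ^ (m + 2 * μ * k) * |ξ| ^ (m + 2 * μ * k) := by
          gcongr
          omega
      _ = _ := by rw [mul_pow]

open MeasureTheory in
lemma tail_bound (μ : ℕ) (hμ : 1 ≤ μ) (β : ℂ) (hβ : 0 < β.re) (γ : ℕ → ℂ) (M : ℕ)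
    (δ : ℝ) (hδ : 0 < δ) :
    ∃ C : ℝ, 0 < C ∧ ∃ c : ℝ, 0 < c ∧ ∀ n : ℕ, 1 ≤ n → ∀ y : ℝ,
      ‖∫ ξ in (Set.Ioc (-δ) δ)ᶜ, Complex.exp (-I * y * (ξ : ℝ)) *
        Complex.exp (-(n * β * (ξ:ℂ) ^ (2 * μ))) * Qmain μ γ M n ξ‖ ≤ C * Real.exp (-c * n) := by
  set b := β.re with hb
  obtain ⟨C, hC, hQ⟩ := Qmain_bound μ hμ γ M (b/2) (by positivity)
  have hitg := integrable_exp_neg_pow (2*μ) (by omega) (b/4) (by positivity)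
  have hJ0 : 0 ≤ ∫ x : ℝ, Real.exp (-(b/4) * |x| ^ (2*μ)) := integral_nonneg fun x => (Real.exp_pos _).le
  refine ⟨C * ((∫ x : ℝ, Real.exp (-(b/4) * |x| ^ (2*μ))) + 1), by positivity, b / 4 * δ ^ (2*μ),
    by positivity, fun n hn y => ?_⟩
  have hn1 : (1:ℝ) ≤ n := by exact_mod_cast hn
  set E := Real.exp (-(b / 4 * δ ^ (2*μ)) * n) with hE
  have hpt : ∀ ξ ∈ (Set.Ioc (-δ) δ)ᶜ, ‖Complex.exp (-I * y * (ξ : ℝ)) *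
        Complex.exp (-(n * β * (ξ:ℂ) ^ (2 * μ))) * Qmain μ γ M n ξ‖ ≤
        C * E * Real.exp (-(b/4) * |ξ| ^ (2*μ)) := by
    intro ξ hξ
    have hξ' : δ ≤ |ξ| := by
      simp only [Set.mem_compl_iff, Set.mem_Ioc, not_and_or, not_lt, not_le] at hξ
      rcases hξ with h | h
      · exact le_abs.2 (Or.inr (by linarith))
      · exact le_abs.2 (Or.inl h.le)
    have e1 : ((ξ : ℂ) ^ (2 * μ)) = ((|ξ| ^ (2 * μ) : ℝ) : ℂ) := by
      rw [pow_mul |ξ|, sq_abs, ← pow_mul]; push_cast; rfl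
    have e2 : (-I * (y:ℂ) * ξ).re = 0 := by simp
    have e3 : (-(n * β * ((|ξ| ^ (2 * μ) : ℝ) : ℂ))).re = -(n * b * |ξ| ^ (2*μ)) := by
      rw [Complex.neg_re, Complex.re_mul_ofReal, ← Complex.ofReal_natCast, Complex.re_ofReal_mul]
    rw [norm_mul, norm_mul, Complex.norm_exp, Complex.norm_exp, e2, e1, e3, Real.exp_zero, one_mul]
    have hp : δ ^ (2*μ) ≤ |ξ| ^ (2*μ) := by gcongr
    calc _ ≤ Real.exp (-(n * b * |ξ| ^ (2*μ))) * (C * Real.exp (b/2 * (n * |ξ| ^ (2 * μ)))) := by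
            gcongr; exact hQ n hn ξ
      _ = C * Real.exp (-(n * b * |ξ| ^ (2*μ)) + b/2 * (n * |ξ| ^ (2 * μ))) := by
            rw [Real.exp_add]; ring
      _ ≤ C * Real.exp (-(b / 4 * δ ^ (2*μ)) * n + -(b/4) * |ξ| ^ (2*μ)) := by
            refine mul_le_mul_of_nonneg_left (Real.exp_le_exp.2 ?_) hC.le
            have h0 : 0 ≤ |ξ| ^ (2*μ) := by positivity
            have h5 : b/4 * n * δ ^ (2*μ) ≤ b/4 * n * |ξ| ^ (2*μ) := by gcongr
            have h6 : b/4 * |ξ| ^ (2*μ) * 1 ≤ b/4 * |ξ| ^ (2*μ) * n := by gcongr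
            linarith
      _ = _ := by rw [Real.exp_add]; ring
  have hms : MeasurableSet (Set.Ioc (-δ) δ)ᶜ := measurableSet_Ioc.compl
  have h1 := norm_integral_le_of_norm_le (μ := volume.restrict (Set.Ioc (-δ) δ)ᶜ)
    (hitg.const_mul (C * E)).integrableOn ((ae_restrict_iff' hms).2 (ae_of_all _ hpt))
  refine h1.trans ?_
  rw [integral_const_mul]
  have h2 : ∫ x in (Set.Ioc (-δ) δ)ᶜ, Real.exp (-(b/4) * |x| ^ (2*μ)) ≤
      ∫ x : ℝ, Real.exp (-(b/4) * |x| ^ (2*μ)) :=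
    setIntegral_le_integral hitg (ae_of_all _ fun x => (Real.exp_pos _).le)
  have hE0 : 0 < E := Real.exp_pos _
  calc _ ≤ C * E * ((∫ x : ℝ, Real.exp (-(b/4) * |x| ^ (2*μ))) + 1) := by gcongr; linarith
    _ = _ := by ring

lemma saddle (μ : ℕ) (hμ : 1 ≤ μ) (B d : ℝ) (hB : 0 < B) (hd : 0 < d) :
    ∃ c : ℝ, 0 < c ∧ ∀ n : ℕ, 1 ≤ n → ∀ y : ℝ, ∃ τ : ℝ, 0 ≤ τ ∧ τ ≤ d ∧
      Real.exp (n * B * τ ^ (2 * μ) - |y| * τ) ≤ Real.exp (-c * n) +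
        Real.exp (-c * (|y| / (n : ℝ) ^ ((1 : ℝ) / (2 * (μ : ℝ)))) ^
          ((2 * (μ : ℝ)) / (2 * (μ : ℝ) - 1))) := by
  obtain ⟨q, hq⟩ : ∃ q, 2 * μ = q + 1 := ⟨2 * μ - 1, by omega⟩
  have hq1 : 1 ≤ q := by omega
  have hqR : (2 * (μ:ℝ)) = q + 1 := by exact_mod_cast hq
  have hq0 : (0:ℝ) < q := by exact_mod_cast hq1
  set c0 : ℝ := min 1 (1 / (2 * B)) with hc0
  have hc00 : 0 < c0 := by positivity
  have hc01 : c0 ≤ 1 := min_le_left _ _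
  have hBc : B * c0 ^ q ≤ 1 / 2 := by
    calc B * c0 ^ q ≤ B * c0 := by
          gcongr
          exact pow_le_of_le_one hc00.le hc01 (by omega)
      _ ≤ B * (1 / (2 * B)) := by gcongr; exact min_le_right _ _
      _ = 1 / 2 := by field_simp
  set c1 := (d / c0) ^ q * d / 2 with hc1
  have hc10 : 0 < c1 := by positivity
  refine ⟨min c1 (c0 / 2), by positivity, fun n hn y => ?_⟩
  have hn0 : (0:ℝ) < n := by exact_mod_cast hn
  set x := (|y| / n) ^ ((1:ℝ) / q) with hx
  have hx0 : 0 ≤ x := by positivity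
  have hxq : x ^ q = |y| / n := by
    rw [hx, one_div, Real.rpow_inv_natCast_pow (by positivity) (by omega)]
  have hyn : |y| = n * x ^ q := by rw [hxq]; field_simp
  have key : ∀ τ, 0 ≤ τ → τ ≤ c0 * x → n * B * τ ^ (2 * μ) - |y| * τ ≤ -(|y| * τ / 2) := by
    intro τ h0 h1
    have h2 : B * τ ^ q ≤ 1 / 2 * x ^ q := by
      calc B * τ ^ q ≤ B * (c0 * x) ^ q := by gcongr
        _ = (B * c0 ^ q) * x ^ q := by rw [mul_pow]; ring
        _ ≤ _ := by gcongr
    have h3 : n * τ * (B * τ ^ q) ≤ n * τ * (1 / 2 * x ^ q) := by gcongr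
    rw [hq, pow_succ, hyn]
    linarith
  rcases le_total d (c0 * x) with h | h
  · refine ⟨d, hd.le, le_rfl, ?_⟩
    refine le_trans (Real.exp_le_exp.2 ?_) (le_add_of_nonneg_right (Real.exp_pos _).le)
    refine (key d hd.le h).trans ?_
    have h1 : d / c0 ≤ x := by rw [div_le_iff₀ hc00]; linarith
    have h2 : n * (d / c0) ^ q ≤ |y| := by rw [hyn]; gcongr
    have h3 : n * (d / c0) ^ q * d ≤ |y| * d := by gcongr
    have h4 : min c1 (c0 / 2) * n ≤ c1 * n := by gcongr; exact min_le_left _ _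
    have h5 : c1 * n = n * (d / c0) ^ q * d / 2 := by rw [hc1]; ring
    linarith
  · refine ⟨c0 * x, by positivity, h, ?_⟩
    refine le_trans (Real.exp_le_exp.2 ?_) (le_add_of_nonneg_left (Real.exp_pos _).le)
    refine (key _ (by positivity) le_rfl).trans ?_
    have e : (|y| / (n : ℝ) ^ ((1 : ℝ) / (2 * (μ : ℝ)))) ^
          ((2 * (μ : ℝ)) / (2 * (μ : ℝ) - 1)) = |y| * x := by
      rw [hqR, hx, add_sub_cancel_right, Real.div_rpow (abs_nonneg _) (by positivity),
        Real.div_rpow (abs_nonneg _) hn0.le, ← Real.rpow_mul hn0.le]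
      have e1 : ((q:ℝ) + 1) / q = 1 + 1 / q := by field_simp
      have e2 : 1 / ((q:ℝ) + 1) * ((q + 1) / q) = 1 / q := by field_simp
      rw [e2, e1, Real.rpow_add' (abs_nonneg _) (by positivity), Real.rpow_one, mul_div_assoc]
    rw [e]
    have h6 : 0 ≤ |y| * x := by positivity
    have h4 : min c1 (c0 / 2) * (|y| * x) ≤ c0 / 2 * (|y| * x) := by
      gcongr; exact min_le_right _ _
    linarith

noncomputable def gfun (μ : ℕ) (β : ℂ) (γ : ℕ → ℂ) (R : ℂ → ℂ) (M n : ℕ) (y : ℝ) (z : ℂ) : ℂ :=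
  Complex.exp (-I * y * z) * Complex.exp (-(n * β * z ^ (2 * μ))) *
    (Complex.exp (n * z ^ (2 * μ) * R z) - Qmain μ γ M n z)

lemma core_bound (μ : ℕ) (hμ : 1 ≤ μ) (β : ℂ) (hβ : 0 < β.re) (γ : ℕ → ℂ)
    (hγ : γ (2 * μ) = 0) (ρ : ℝ) (hρ : 0 < ρ) (R : ℂ → ℂ)
    (hR : ∀ w : ℂ, ‖w‖ < ρ → HasSum (fun j => rcoef μ γ j * w ^ j) (R w)) (M : ℕ) :
    ∃ ρ0 C B : ℝ, 0 < ρ0 ∧ 0 < C ∧ 0 < B ∧ ρ0 < ρ ∧ DifferentiableOn ℂ R (Metric.ball 0 ρ0) ∧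
      ∀ n : ℕ, 1 ≤ n → ∀ y ξ η : ℝ, ‖(ξ : ℂ) + η * I‖ ≤ ρ0 / 2 →
        ‖gfun μ β γ R M n y ((ξ : ℂ) + η * I)‖ ≤
          C * (n : ℝ) ^ (-((M : ℝ) + 1) / (2 * (μ : ℝ))) *
            Real.exp (y * η - n * (β.re / 2) * |ξ| ^ (2 * μ) + n * B * |η| ^ (2 * μ)) := by
  obtain ⟨θ, hθ, B, hB, hker⟩ := kernel_bound μ β hβ
  obtain ⟨ρ0, hρ0, hρ0ρ, hdiff, hexp⟩ := exp_expansion (rcoef μ γ) (by simp [rcoef, hγ]) ρ hρ R hR θ hθ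
  obtain ⟨C1, hC1, hC⟩ := pow_le_exp_bound (M + 1) (2 * μ) (by omega) θ hθ
  refine ⟨ρ0, 2 * C1 / ρ0 ^ (M + 1), B, hρ0, by positivity, hB, hρ0ρ, hdiff, ?_⟩
  intro n hn y ξ η hz
  obtain ⟨ha0, ha1, hap, hpow⟩ := scale_facts μ hμ n hn
  set a : ℝ := (n : ℝ) ^ ((1:ℝ) / (2 * (μ:ℝ))) with ha
  have hk := hker ξ η
  have him : (-I * y * ((ξ : ℂ) + η * I)).re = y * η := by simp
  set z : ℂ := (ξ : ℂ) + η * I with hzdef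
  have h1 := hexp (M + 1) (n * z ^ (2 * μ)) z hz
  have hs : ‖(n : ℂ) * z ^ (2 * μ)‖ = n * ‖z‖ ^ (2 * μ) := by
    rw [norm_mul, norm_pow, Complex.norm_natCast]
  rw [hs] at h1
  have h2 := hC (a * ‖z‖) (by positivity)
  rw [mul_pow a ‖z‖ (2 * μ), hap, mul_pow] at h2
  have h3 : ‖z‖ ^ (M + 1) ≤ (a ^ (M + 1))⁻¹ * (C1 * Real.exp (θ * (n * ‖z‖ ^ (2 * μ)))) := by
    rw [← div_eq_inv_mul, le_div_iff₀ (by positivity)]; linarith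
  have h4 : ‖Complex.exp (n * z ^ (2 * μ) * R z) - Qmain μ γ M n z‖ ≤
      2 * C1 / ρ0 ^ (M + 1) * (a ^ (M + 1))⁻¹ * Real.exp (2 * θ * (n * ‖z‖ ^ (2 * μ))) := by
    refine h1.trans ?_
    rw [div_pow]
    calc _ ≤ 2 * Real.exp (θ * (n * ‖z‖ ^ (2 * μ))) * (((a ^ (M + 1))⁻¹ *
          (C1 * Real.exp (θ * (n * ‖z‖ ^ (2 * μ))))) / ρ0 ^ (M + 1)) := by gcongr
      _ = 2 * C1 / ρ0 ^ (M + 1) * (a ^ (M + 1))⁻¹ * (Real.exp (θ * (n * ‖z‖ ^ (2 * μ))) *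
          Real.exp (θ * (n * ‖z‖ ^ (2 * μ)))) := by ring
      _ = _ := by rw [← Real.exp_add]; ring_nf
  have e3 : (-(n * β * z ^ (2 * μ))).re = n * (-β * z ^ (2 * μ)).re := by
    rw [show -(n * β * z ^ (2 * μ)) = ((n : ℝ) : ℂ) * (-β * z ^ (2 * μ)) by push_cast; ring,
      Complex.re_ofReal_mul]
  rw [gfun, norm_mul, norm_mul, Complex.norm_exp, Complex.norm_exp, him, e3, hpow M]
  have hn0 : (0:ℝ) ≤ n := Nat.cast_nonneg n
  calc _ ≤ Real.exp (y * η) * Real.exp (n * (-β * z ^ (2 * μ)).re) *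
        (2 * C1 / ρ0 ^ (M + 1) * (a ^ (M + 1))⁻¹ * Real.exp (2 * θ * (n * ‖z‖ ^ (2 * μ)))) := by gcongr
    _ = 2 * C1 / ρ0 ^ (M + 1) * (a ^ (M + 1))⁻¹ *
        Real.exp (y * η + n * ((-β * z ^ (2 * μ)).re + 2 * θ * ‖z‖ ^ (2 * μ))) := by
        rw [mul_add, Real.exp_add, Real.exp_add]; ring_nf
    _ ≤ _ := by
        refine mul_le_mul_of_nonneg_left (Real.exp_le_exp.2 ?_) (by positivity)
        have := mul_le_mul_of_nonneg_left hk hn0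
        linarith

lemma shift_contour (g : ℂ → ℂ) (ρ0 δ η K1 : ℝ) (hδ : 0 < δ) (hη : |η| ≤ δ) (hδρ : δ ≤ ρ0 / 4)
    (hg : DifferentiableOn ℂ g (Metric.ball 0 ρ0))
    (hside : ∀ t : ℝ, t ∈ Set.uIoc 0 η → ‖g ((δ : ℝ) + t * I)‖ ≤ K1 ∧ ‖g ((-δ : ℝ) + t * I)‖ ≤ K1) :
    ‖∫ x in (-δ)..δ, g (x : ℝ)‖ ≤ ‖∫ x in (-δ)..δ, g ((x : ℝ) + η * I)‖ + 2 * (K1 * |η|) := by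
  have h := Complex.integral_boundary_rect_eq_zero_of_differentiableOn g ((-δ : ℝ) : ℂ) ((δ : ℝ) + η * I) (by
    refine hg.mono ?_
    intro z hz
    rw [Complex.mem_reProdIm] at hz
    obtain ⟨h1, h2⟩ := hz
    simp only [Complex.ofReal_re, Complex.add_re, Complex.mul_re, Complex.I_re, Complex.I_im,
      Complex.ofReal_im, Complex.add_im, Complex.mul_im, mul_zero, mul_one, sub_zero, add_zero, zero_add] at h1 h2
    rw [Set.uIcc_of_le (by linarith)] at h1
    have h3 : |z.re| ≤ δ := abs_le.2 h1
    have h4 : |z.im| ≤ |η| := by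
      have := Set.abs_sub_left_of_mem_uIcc h2
      simpa using this
    have := Complex.norm_le_abs_re_add_abs_im z
    simp only [Metric.mem_ball, dist_zero_right]
    linarith)
  simp only [Complex.ofReal_re, Complex.add_re, Complex.mul_re, Complex.I_re, Complex.I_im,
      Complex.ofReal_im, Complex.add_im, Complex.mul_im, mul_zero, mul_one, sub_zero, add_zero, zero_add,
      Complex.ofReal_zero, zero_mul] at h
  have b1 : ‖∫ t in (0:ℝ)..η, g ((δ : ℝ) + t * I)‖ ≤ K1 * |η - 0| :=
    intervalIntegral.norm_integral_le_of_norm_le_const fun t ht => (hside t ht).1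
  have b2 : ‖∫ t in (0:ℝ)..η, g ((-δ : ℝ) + t * I)‖ ≤ K1 * |η - 0| :=
    intervalIntegral.norm_integral_le_of_norm_le_const fun t ht => (hside t ht).2
  rw [sub_zero] at b1 b2
  have e : ∫ x in (-δ)..δ, g (x : ℝ) = (∫ x in (-δ)..δ, g ((x : ℝ) + η * I)) -
      I * (∫ t in (0:ℝ)..η, g ((δ : ℝ) + t * I)) + I * (∫ t in (0:ℝ)..η, g ((-δ : ℝ) + t * I)) := by
    simp only [smul_eq_mul] at h
    linear_combination h
  rw [e]
  refine (norm_add_le _ _).trans ?_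
  have := norm_sub_le (∫ x in (-δ)..δ, g ((x : ℝ) + η * I)) (I * (∫ t in (0:ℝ)..η, g ((δ : ℝ) + t * I)))
  rw [norm_mul, Complex.norm_I, one_mul] at this ⊢
  linarith

lemma gfun_diff (μ : ℕ) (β : ℂ) (γ : ℕ → ℂ) (R : ℂ → ℂ) (M n : ℕ) (y : ℝ) (s : Set ℂ)
    (hR : DifferentiableOn ℂ R s) : DifferentiableOn ℂ (gfun μ β γ R M n y) s := by
  have hQ : Differentiable ℂ (Qmain μ γ M n) := by
    rw [funext (Qmain_eq μ γ M n)]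
    fun_prop
  unfold gfun
  have h1 : Differentiable ℂ (fun z : ℂ => Complex.exp (-I * y * z) * Complex.exp (-(n * β * z ^ (2 * μ)))) := by
    fun_prop
  have h2 : Differentiable ℂ (fun z : ℂ => (n : ℂ) * z ^ (2 * μ)) := by fun_prop
  exact h1.differentiableOn.mul (((h2.differentiableOn.mul hR).cexp).sub hQ.differentiableOn)

lemma shift_bound (μ : ℕ) (hμ : 1 ≤ μ) (β : ℂ) (hβ : 0 < β.re) (γ : ℕ → ℂ) (R : ℂ → ℂ) (M : ℕ)
    (ρ0 C B : ℝ) (hC : 0 < C) (hB : 0 < B)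
    (hdiff : DifferentiableOn ℂ R (Metric.ball 0 ρ0))
    (hcore : ∀ n : ℕ, 1 ≤ n → ∀ y ξ η : ℝ, ‖(ξ : ℂ) + η * I‖ ≤ ρ0 / 2 →
        ‖gfun μ β γ R M n y ((ξ : ℂ) + η * I)‖ ≤
          C * (n : ℝ) ^ (-((M : ℝ) + 1) / (2 * (μ : ℝ))) *
            Real.exp (y * η - n * (β.re / 2) * |ξ| ^ (2 * μ) + n * B * |η| ^ (2 * μ)))
    (δ : ℝ) (hδ : 0 < δ) (hδρ : δ ≤ ρ0 / 4) :
    ∃ C' : ℝ, 0 < C' ∧ ∃ c : ℝ, 0 < c ∧ ∀ n : ℕ, 1 ≤ n → ∀ y : ℝ,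
      ‖∫ x in (-δ)..δ, gfun μ β γ R M n y (x : ℝ)‖ ≤ C' * Real.exp (-c * n) +
        C' * ((n : ℝ) ^ (-((M : ℝ) + 2) / (2 * (μ : ℝ))) *
          Real.exp (-c * (|y| / (n : ℝ) ^ ((1 : ℝ) / (2 * (μ : ℝ)))) ^
            ((2 * (μ : ℝ)) / (2 * (μ : ℝ) - 1)))) := by
  set b := β.re with hb
  set t0 := min 1 (b / (4 * B)) with ht0
  have ht00 : 0 < t0 := by positivity
  have ht01 : t0 ≤ 1 := min_le_left _ _
  set d := t0 * δ with hd
  have hd0 : 0 < d := by positivity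
  have hdδ : d ≤ δ := by rw [hd]; nlinarith
  have hBd : B * d ^ (2 * μ) ≤ b / 4 * δ ^ (2 * μ) := by
    rw [hd, mul_pow, ← mul_assoc]
    gcongr
    calc B * t0 ^ (2 * μ) ≤ B * t0 := by
          gcongr; exact pow_le_of_le_one ht00.le ht01 (by omega)
      _ ≤ B * (b / (4 * B)) := by gcongr; exact min_le_right _ _
      _ = b / 4 := by field_simp
  obtain ⟨c1, hc1, hsad⟩ := saddle μ hμ B d hB hd0
  obtain ⟨J, hJ, hscale⟩ := scaled_integral_le (2 * μ) (by omega) (b / 2) (by positivity)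
  refine ⟨C * J + 2 * (C * d), by positivity, min c1 (b / 4 * δ ^ (2 * μ)), by positivity, fun n hn y => ?_⟩
  have hn1 : (1:ℝ) ≤ n := by exact_mod_cast hn
  have hn0 : (0:ℝ) < n := by linarith
  have hμ0 : (0:ℝ) < μ := by exact_mod_cast hμ
  obtain ⟨τ, hτ0, hτd, hτ⟩ := hsad n hn y
  obtain ⟨η, hη1, hη2, hη3⟩ : ∃ η : ℝ, |η| = τ ∧ y * η = -(|y| * τ) ∧
      ∀ t ∈ Set.uIoc 0 η, y * t ≤ 0 ∧ |t| ≤ τ := by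
    rcases le_total 0 y with h | h
    · refine ⟨-τ, by simp [abs_of_nonneg hτ0], by rw [abs_of_nonneg h]; ring, fun t ht => ?_⟩
      rw [Set.uIoc_of_ge (by linarith)] at ht
      exact ⟨mul_nonpos_of_nonneg_of_nonpos h ht.2, abs_le.2 ⟨ht.1.le, ht.2.trans hτ0⟩⟩
    · refine ⟨τ, abs_of_nonneg hτ0, by rw [abs_of_nonpos h]; ring, fun t ht => ?_⟩
      rw [Set.uIoc_of_le hτ0] at ht
      exact ⟨mul_nonpos_of_nonpos_of_nonneg h ht.1.le, abs_le.2 ⟨by linarith [ht.1], ht.2⟩⟩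
  set X := (|y| / (n : ℝ) ^ ((1 : ℝ) / (2 * (μ : ℝ)))) ^ ((2 * (μ : ℝ)) / (2 * (μ : ℝ) - 1)) with hX
  have hX0 : 0 ≤ X := by positivity
  set P1 := (n : ℝ) ^ (-((M : ℝ) + 1) / (2 * (μ : ℝ))) with hP1
  set P2 := (n : ℝ) ^ (-((M : ℝ) + 2) / (2 * (μ : ℝ))) with hP2
  have hP10 : 0 < P1 := by positivity
  have hP20 : 0 < P2 := by positivity
  have hle1 : ∀ q : ℝ, 0 ≤ q → (n : ℝ) ^ (-q / (2 * (μ : ℝ))) ≤ 1 := by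
    intro q hq
    apply Real.rpow_le_one_of_one_le_of_nonpos hn1
    rw [neg_div]
    have : 0 ≤ q / (2 * (μ:ℝ)) := by positivity
    linarith
  have hP11 : P1 ≤ 1 := hle1 _ (by positivity)
  have hP21 : P2 ≤ 1 := hle1 _ (by positivity)
  have hP12 : P1 * (n : ℝ) ^ (-(1:ℝ) / ((2 * μ : ℕ) : ℝ)) = P2 := by
    rw [hP1, hP2, ← Real.rpow_add hn0]
    congr 1
    push_cast
    ring
  set E := Real.exp (-c1 * n) + Real.exp (-c1 * X) with hE
  have hE0 : 0 < E := by positivity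
  set K1 := C * Real.exp (-(b / 4 * δ ^ (2 * μ)) * n) with hK1
  have hnorm : ∀ u v : ℝ, |u| ≤ δ → |v| ≤ δ → ‖(u : ℂ) + v * I‖ ≤ ρ0 / 2 := by
    intro u v hu hv
    have := Complex.norm_le_abs_re_add_abs_im ((u : ℂ) + v * I)
    simp at this
    linarith
  have hside' : ∀ u : ℝ, |u| = δ → ∀ t ∈ Set.uIoc 0 η, ‖gfun μ β γ R M n y ((u : ℝ) + t * I)‖ ≤ K1 := by
    intro u hu t ht
    obtain ⟨h1, h2⟩ := hη3 t ht
    refine (hcore n hn y u t (hnorm u t hu.le (by linarith))).trans ?_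
    have h3 : |t| ^ (2 * μ) ≤ d ^ (2 * μ) := by gcongr; linarith
    have h4 : B * |t| ^ (2 * μ) ≤ b / 4 * δ ^ (2 * μ) := le_trans (by gcongr) hBd
    have h5 := mul_le_mul_of_nonneg_left h4 hn0.le
    rw [hK1, hu]
    calc _ ≤ C * 1 * Real.exp (-(b / 4 * δ ^ (2 * μ)) * n) := by
          refine mul_le_mul (by gcongr) (Real.exp_le_exp.2 ?_) (Real.exp_pos _).le (by positivity)
          linarith
      _ = _ := by ring
  have hsh := shift_contour (gfun μ β γ R M n y) ρ0 δ η K1 hδ (by linarith) hδρ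
    (gfun_diff μ β γ R M n y _ hdiff) (fun t ht => ⟨hside' δ (abs_of_pos hδ) t ht,
      hside' (-δ) (by rw [abs_neg, abs_of_pos hδ]) t ht⟩)
  have hhor : ‖∫ x in (-δ)..δ, gfun μ β γ R M n y ((x : ℝ) + η * I)‖ ≤
      ∫ x in (-δ)..δ, C * P1 * E * Real.exp (-(n * (b / 2) * |x| ^ (2 * μ))) := by
    apply intervalIntegral.norm_integral_le_of_norm_le (by linarith)
    · refine Filter.Eventually.of_forall fun x hx => ?_
      have hx' : |x| ≤ δ := abs_le.2 ⟨hx.1.le, hx.2⟩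
      refine (hcore n hn y x η (hnorm x η hx' (by linarith))).trans ?_
      rw [hη1, hη2]
      calc _ = C * P1 * (Real.exp (n * B * τ ^ (2 * μ) - |y| * τ) *
            Real.exp (-(n * (b / 2) * |x| ^ (2 * μ)))) := by
            rw [← Real.exp_add]; congr 2; ring
        _ ≤ C * P1 * (E * Real.exp (-(n * (b / 2) * |x| ^ (2 * μ)))) := by gcongr
        _ = _ := by ring
    · apply Continuous.intervalIntegrable
      fun_prop
  rw [intervalIntegral.integral_const_mul] at hhor
  have hhor2 : ‖∫ x in (-δ)..δ, gfun μ β γ R M n y ((x : ℝ) + η * I)‖ ≤ C * J * (P2 * E) := by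
    refine hhor.trans ?_
    calc _ ≤ C * P1 * E * (J * (n : ℝ) ^ (-(1:ℝ) / ((2 * μ : ℕ) : ℝ))) := by
          gcongr; exact hscale n hn δ hδ
      _ = C * J * ((P1 * (n : ℝ) ^ (-(1:ℝ) / ((2 * μ : ℕ) : ℝ))) * E) := by ring
      _ = _ := by rw [hP12]
  set c := min c1 (b / 4 * δ ^ (2 * μ)) with hc
  have x1 : Real.exp (-c1 * n) ≤ Real.exp (-c * n) := by
    apply Real.exp_le_exp.2
    have : c * n ≤ c1 * n := by gcongr; exact min_le_left _ _
    linarith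
  have x2 : Real.exp (-c1 * X) ≤ Real.exp (-c * X) := by
    apply Real.exp_le_exp.2
    have : c * X ≤ c1 * X := by gcongr; exact min_le_left _ _
    linarith
  have x3 : Real.exp (-(b / 4 * δ ^ (2 * μ)) * n) ≤ Real.exp (-c * n) := by
    apply Real.exp_le_exp.2
    have : c * n ≤ (b / 4 * δ ^ (2 * μ)) * n := by gcongr; exact min_le_right _ _
    linarith
  have y1 : P2 * E ≤ Real.exp (-c * n) + P2 * Real.exp (-c * X) := by
    calc P2 * E ≤ P2 * (Real.exp (-c * n) + Real.exp (-c * X)) := by rw [hE]; gcongr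
      _ = P2 * Real.exp (-c * n) + P2 * Real.exp (-c * X) := by ring
      _ ≤ 1 * Real.exp (-c * n) + P2 * Real.exp (-c * X) := by gcongr
      _ = _ := by ring
  have y2 : K1 * |η| ≤ C * d * Real.exp (-c * n) := by
    rw [hη1, hK1]
    calc _ ≤ C * Real.exp (-c * n) * d := by gcongr
      _ = _ := by ring
  have y3 : C * J * (P2 * E) ≤ C * J * (Real.exp (-c * n) + P2 * Real.exp (-c * X)) := by gcongr
  have y4 : 0 ≤ 2 * (C * d) * (P2 * Real.exp (-c * X)) := by positivity
  linarith

open MeasureTheory in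
lemma local_lemma (μ : ℕ) (hμ : 1 ≤ μ) (β : ℂ) (hβ : 0 < β.re) (γ : ℕ → ℂ)
    (hγ : γ (2 * μ) = 0) (ρ : ℝ) (hρ : 0 < ρ) (R : ℂ → ℂ)
    (hR : ∀ w : ℂ, ‖w‖ < ρ → HasSum (fun j => rcoef μ γ j * w ^ j) (R w)) (M : ℕ) :
    ∃ δ0 : ℝ, 0 < δ0 ∧ δ0 < ρ ∧ ∀ δ : ℝ, 0 < δ → δ ≤ δ0 →
      ∃ C : ℝ, 0 < C ∧ ∃ c : ℝ, 0 < c ∧ ∀ n : ℕ, 1 ≤ n → ∀ y : ℝ,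
      ‖(1 / (2 * Real.pi : ℂ)) * (∫ x in (-δ)..δ, Complex.exp (-I * y * (x : ℝ)) *
          Complex.exp (-(n * β * (x : ℂ) ^ (2 * μ))) * Complex.exp (n * (x : ℂ) ^ (2 * μ) * R x)) -
        ∑ m ∈ Finset.range (M + 1), (((n : ℝ) ^ (-((m : ℝ) + 1) / (2 * (μ : ℝ))) : ℝ) : ℂ) *
          PdiffH μ γ m (Hfun μ β) (y / (n : ℝ) ^ ((1 : ℝ) / (2 * (μ : ℝ))))‖ ≤
        C * Real.exp (-c * n) +
        C * ((n : ℝ) ^ (-((M : ℝ) + 2) / (2 * (μ : ℝ))) *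
          Real.exp (-c * (|y| / (n : ℝ) ^ ((1 : ℝ) / (2 * (μ : ℝ)))) ^
            ((2 * (μ : ℝ)) / (2 * (μ : ℝ) - 1)))) := by
  obtain ⟨ρ0, C0, B, hρ0, hC0, hB, hρρ, hdiff, hcore⟩ := core_bound μ hμ β hβ γ hγ ρ hρ R hR M
  refine ⟨ρ0 / 4, by positivity, by linarith, fun δ hδ hδρ => ?_⟩
  obtain ⟨C1, hC1, c1, hc1, h1⟩ := shift_bound μ hμ β hβ γ R M ρ0 C0 B hC0 hB hdiff hcore δ hδ hδρ
  obtain ⟨C2, hC2, c2, hc2, h2⟩ := tail_bound μ hμ β hβ γ M δ hδ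
  refine ⟨C1 + C2, by positivity, min c1 c2, by positivity, fun n hn y => ?_⟩
  have hn0 : (0:ℝ) ≤ n := Nat.cast_nonneg n
  obtain ⟨hitg, hmain⟩ := main_eq μ hμ β hβ γ M n hn y
  rw [hmain]
  set W : ℝ → ℂ := fun ξ => Complex.exp (-I * y * ξ) * Complex.exp (-(n * β * (ξ:ℂ) ^ (2 * μ))) *
        Qmain μ γ M n ξ with hW
  have hsplit : ∫ ξ : ℝ, W ξ = (∫ x in (-δ)..δ, W x) + ∫ ξ in (Set.Ioc (-δ) δ)ᶜ, W ξ := by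
    rw [intervalIntegral.integral_of_le (by linarith), integral_add_compl measurableSet_Ioc hitg]
  have hg : IntervalIntegrable (fun x : ℝ => gfun μ β γ R M n y x) volume (-δ) δ := by
    apply ContinuousOn.intervalIntegrable
    rw [Set.uIcc_of_le (by linarith)]
    refine (gfun_diff μ β γ R M n y _ hdiff).continuousOn.comp (by fun_prop) ?_
    intro x hx
    have : |x| ≤ δ := abs_le.2 hx
    simp
    linarith
  have hdec : ∫ x in (-δ)..δ, Complex.exp (-I * y * (x : ℝ)) *
          Complex.exp (-(n * β * (x : ℂ) ^ (2 * μ))) * Complex.exp (n * (x : ℂ) ^ (2 * μ) * R x) =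
      (∫ x in (-δ)..δ, gfun μ β γ R M n y (x : ℝ)) + ∫ x in (-δ)..δ, W x := by
    rw [← intervalIntegral.integral_add hg hitg.intervalIntegrable]
    refine intervalIntegral.integral_congr fun x _ => ?_
    simp only [gfun, hW]
    ring
  rw [hsplit, hdec]
  have e : (1 / (2 * Real.pi : ℂ)) * ((∫ x in (-δ)..δ, gfun μ β γ R M n y (x : ℝ)) + ∫ x in (-δ)..δ, W x) -
      (1 / (2 * Real.pi : ℂ)) * ((∫ x in (-δ)..δ, W x) + ∫ ξ in (Set.Ioc (-δ) δ)ᶜ, W ξ) =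
      (1 / (2 * Real.pi : ℂ)) * ((∫ x in (-δ)..δ, gfun μ β γ R M n y (x : ℝ)) -
        ∫ ξ in (Set.Ioc (-δ) δ)ᶜ, W ξ) := by ring
  rw [e, norm_mul]
  have hpi : ‖(1 / (2 * Real.pi : ℂ))‖ ≤ 1 := by
    rw [show (1 / (2 * Real.pi : ℂ)) = ((1 / (2 * Real.pi) : ℝ) : ℂ) by push_cast; rfl,
      Complex.norm_real, Real.norm_of_nonneg (by positivity), div_le_one (by positivity)]
    linarith [Real.pi_gt_three]
  set X := (|y| / (n : ℝ) ^ ((1 : ℝ) / (2 * (μ : ℝ)))) ^ ((2 * (μ : ℝ)) / (2 * (μ : ℝ) - 1)) with hX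
  have hX0 : 0 ≤ X := by positivity
  set P2 := (n : ℝ) ^ (-((M : ℝ) + 2) / (2 * (μ : ℝ))) with hP2
  have hP20 : 0 ≤ P2 := by positivity
  set c := min c1 c2 with hc
  have x1 : Real.exp (-c1 * n) ≤ Real.exp (-c * n) := by
    apply Real.exp_le_exp.2
    have : c * n ≤ c1 * n := by gcongr; exact min_le_left _ _
    linarith
  have x2 : Real.exp (-c1 * X) ≤ Real.exp (-c * X) := by
    apply Real.exp_le_exp.2
    have : c * X ≤ c1 * X := by gcongr; exact min_le_left _ _
    linarith
  have x3 : Real.exp (-c2 * n) ≤ Real.exp (-c * n) := by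
    apply Real.exp_le_exp.2
    have : c * n ≤ c2 * n := by gcongr; exact min_le_right _ _
    linarith
  calc _ ≤ 1 * (‖∫ x in (-δ)..δ, gfun μ β γ R M n y (x : ℝ)‖ + ‖∫ ξ in (Set.Ioc (-δ) δ)ᶜ, W ξ‖) := by
        gcongr; exact norm_sub_le _ _
    _ ≤ 1 * ((C1 * Real.exp (-c1 * n) + C1 * (P2 * Real.exp (-c1 * X))) + C2 * Real.exp (-c2 * n)) := by
        gcongr
        · exact h1 n hn y
        · exact h2 n hn y
    _ ≤ 1 * ((C1 * Real.exp (-c * n) + C1 * (P2 * Real.exp (-c * X))) + C2 * Real.exp (-c * n)) := by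
        gcongr
    _ ≤ _ := by
        have : 0 ≤ C2 * (P2 * Real.exp (-c * X)) := by positivity
        linarith

lemma get_R (μ : ℕ) (γ : ℕ → ℂ) (hγ : ∀ ν : ℕ, ν < 2 * μ + 1 → γ ν = 0) (w s : ℂ)
    (hs : HasSum (fun ν : ℕ => γ ν * (I * w) ^ ν / (Nat.factorial ν : ℂ)) s) :
    HasSum (fun j => rcoef μ γ j * w ^ j) (∑' j, rcoef μ γ j * w ^ j) ∧
      s = w ^ (2 * μ) * ∑' j, rcoef μ γ j * w ^ j := by
  have h1 : HasSum (fun j : ℕ => w ^ (2 * μ) * (rcoef μ γ j * w ^ j)) s := by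
    have h0 := (hasSum_nat_add_iff' (2 * μ)).2 hs
    rw [Finset.sum_eq_zero, sub_zero] at h0
    · refine h0.congr_fun ?_
      intro j
      simp only [rcoef]
      rw [add_comm j (2 * μ), mul_pow, pow_add w]
      ring
    · intro i hi
      rw [hγ i (by have := Finset.mem_range.1 hi; omega)]
      simp
  by_cases hw : w = 0
  · subst hw
    have h2 : HasSum (fun j => rcoef μ γ j * (0:ℂ) ^ j) (rcoef μ γ 0 * 0 ^ 0) :=
      hasSum_single 0 (fun j hj => by simp [hj])
    refine ⟨h2.summable.hasSum, ?_⟩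
    have h3 := h1.unique (h2.mul_left _)
    rw [h2.tsum_eq]; exact h3
  · have hw2 : w ^ (2 * μ) ≠ 0 := pow_ne_zero _ hw
    have h2 : Summable (fun j => rcoef μ γ j * w ^ j) := (summable_mul_left_iff hw2).1 h1.summable
    exact ⟨h2.hasSum, h1.unique (h2.hasSum.mul_left _)⟩

lemma arc_lemma (F : ℂ → ℂ) (κ : ℂ) (hκ : ‖κ‖ = 1) (hFκ : ‖F κ‖ = 1) (α : ℝ)
    (μ : ℕ) (hμ : 1 ≤ μ) (β : ℂ) (hβ : 0 < β.re) (γ : ℕ → ℂ)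
    (hγ : ∀ ν : ℕ, ν < 2 * μ + 1 → γ ν = 0)
    (hexp : ∃ ρ : ℝ, 0 < ρ ∧ ∀ ξ : ℂ, ‖ξ‖ < ρ → ∃ s : ℂ,
      HasSum (fun ν : ℕ => γ ν * (Complex.I * ξ) ^ ν / (Nat.factorial ν : ℂ)) s ∧
      F (κ * Complex.exp (Complex.I * ξ)) =
        F κ * Complex.exp (Complex.I * α * ξ - β * ξ ^ (2 * μ) + s)) (M : ℕ) :
    ∃ δ0 : ℝ, 0 < δ0 ∧ ∀ δ : ℝ, 0 < δ → δ ≤ δ0 →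
      ∃ C : ℝ, 0 < C ∧ ∃ c : ℝ, 0 < c ∧ ∀ n : ℕ, 1 ≤ n → ∀ ℓ : ℤ,
      ‖(1 / (2 * Real.pi : ℂ)) * (∫ x in (-δ)..δ, F (κ * Complex.exp (I * (x : ℝ))) ^ n *
          (κ * Complex.exp (I * (x : ℝ))) ^ (-ℓ)) -
        ∑ m ∈ Finset.range (M + 1), κ ^ (-ℓ) * F κ ^ n *
          (((n : ℝ) ^ (-((m : ℝ) + 1) / (2 * (μ : ℝ))) : ℝ) : ℂ) *
          PdiffH μ γ m (Hfun μ β) (((ℓ : ℝ) - α * n) / (n : ℝ) ^ ((1 : ℝ) / (2 * (μ : ℝ))))‖ ≤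
        C * Real.exp (-c * n) +
        C * ((n : ℝ) ^ (-((M : ℝ) + 2) / (2 * (μ : ℝ))) *
          Real.exp (-c * (|(ℓ : ℝ) - α * n| / (n : ℝ) ^ ((1 : ℝ) / (2 * (μ : ℝ)))) ^
            ((2 * (μ : ℝ)) / (2 * (μ : ℝ) - 1)))) := by
  obtain ⟨ρ, hρ, hex⟩ := hexp
  obtain ⟨δ0, hδ0, hδρ, hloc⟩ := local_lemma μ hμ β hβ γ (hγ _ (by omega)) ρ hρ
    (fun w => ∑' j, rcoef μ γ j * w ^ j)
    (fun w hw => by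
      obtain ⟨s, hs, -⟩ := hex w hw
      exact (get_R μ γ hγ w s hs).1) M
  refine ⟨δ0, hδ0, fun δ hδ hδδ => ?_⟩
  obtain ⟨C, hC, c, hc, h⟩ := hloc δ hδ hδδ
  refine ⟨C, hC, c, hc, fun n hn ℓ => ?_⟩
  refine le_trans (le_of_eq ?_) (h n hn ((ℓ : ℝ) - α * n))
  have hitg : (∫ x in (-δ)..δ, F (κ * Complex.exp (I * (x : ℝ))) ^ n *
          (κ * Complex.exp (I * (x : ℝ))) ^ (-ℓ)) = κ ^ (-ℓ) * F κ ^ n *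
      ∫ x in (-δ)..δ, Complex.exp (-I * ((ℓ : ℝ) - α * n : ℝ) * (x : ℝ)) *
          Complex.exp (-(n * β * (x : ℂ) ^ (2 * μ))) *
          Complex.exp (n * (x : ℂ) ^ (2 * μ) * ∑' j, rcoef μ γ j * (x : ℂ) ^ j) := by
    rw [← intervalIntegral.integral_const_mul]
    apply intervalIntegral.integral_congr
    intro x hx
    rw [Set.uIcc_of_le (by linarith)] at hx
    have hx' : ‖(x : ℂ)‖ < ρ := by
      rw [Complex.norm_real, Real.norm_eq_abs]
      exact (abs_le.2 hx).trans_lt (by linarith)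
    obtain ⟨s, hs, hF⟩ := hex x hx'
    obtain ⟨-, hsR⟩ := get_R μ γ hγ x s hs
    simp only
    rw [hF, mul_pow, mul_zpow, ← Complex.exp_nat_mul, ← Complex.exp_int_mul, ← Complex.exp_add,
      ← Complex.exp_add]
    rw [show F κ ^ n * cexp (↑n * (I * ↑α * ↑x - β * ↑x ^ (2 * μ) + s)) *
      (κ ^ (-ℓ) * cexp (((-ℓ : ℤ) : ℂ) * (I * ↑x))) = κ ^ (-ℓ) * F κ ^ n *
       (cexp (↑n * (I * ↑α * ↑x - β * ↑x ^ (2 * μ) + s)) * cexp (((-ℓ : ℤ) : ℂ) * (I * ↑x))) by ring,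
       ← Complex.exp_add]
    congr 2
    rw [mul_assoc (n : ℂ) ((x:ℂ) ^ (2 * μ)), ← hsR]
    push_cast
    ring
  rw [hitg]
  have hnorm : ‖κ ^ (-ℓ) * F κ ^ n‖ = 1 := by
    rw [norm_mul, norm_zpow, norm_pow, hκ, hFκ]; simp
  have hrw : ∀ z w : ℂ, ‖κ ^ (-ℓ) * F κ ^ n * z - κ ^ (-ℓ) * F κ ^ n * w‖ = ‖z - w‖ := by
    intro z w
    rw [← mul_sub, norm_mul, hnorm, one_mul]
  refine Eq.trans ?_ (hrw _ _)
  rw [Finset.mul_sum]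
  congr 2
  · ring
  · refine Finset.sum_congr rfl fun m _ => ?_
    ring

lemma conv_facts (a b : ℤ → ℂ) (ha : Summable fun ℓ => ‖a ℓ‖) (hb : Summable fun ℓ => ‖b ℓ‖) :
    (Summable fun ℓ => ‖conv a b ℓ‖) ∧ ∀ ζ A B : ℂ, ‖ζ‖ = 1 → HasSum (fun ℓ => a ℓ * ζ ^ ℓ) A →
      HasSum (fun ℓ => b ℓ * ζ ^ ℓ) B → HasSum (fun ℓ => conv a b ℓ * ζ ^ ℓ) (A * B) := by
  let e : ℤ × ℤ ≃ ℤ × ℤ :=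
    { toFun := fun p => (p.1 - p.2, p.2)
      invFun := fun p => (p.1 + p.2, p.2)
      left_inv := fun p => by simp
      right_inv := fun p => by simp }
  have hab : Summable fun p : ℤ × ℤ => ‖a (p.1 - p.2) * b p.2‖ := by
    have h := (ha.mul_of_nonneg hb (fun _ => norm_nonneg _) (fun _ => norm_nonneg _))
    have h2 := e.summable_iff.2 h
    refine h2.congr fun p => ?_
    simp [e]
  have hrow : ∀ ℓ, Summable fun ℓ' => ‖a (ℓ - ℓ') * b ℓ'‖ := fun ℓ => hab.prod_factor ℓ
  constructor
  · refine Summable.of_nonneg_of_le (fun _ => norm_nonneg _) (fun ℓ => ?_) hab.prod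
    exact norm_tsum_le_tsum_norm (hrow ℓ)
  · intro ζ A B hζ hA hB
    have hζ0 : ζ ≠ 0 := by intro h; simp [h] at hζ
    have hn : ∀ (f : ℤ → ℂ), (fun ℓ => ‖f ℓ * ζ ^ ℓ‖) = fun ℓ => ‖f ℓ‖ := by
      intro f; ext ℓ; rw [norm_mul, norm_zpow, hζ]; simp
    have hs : Summable fun p : ℤ × ℤ => (a p.1 * ζ ^ p.1) * (b p.2 * ζ ^ p.2) := by
      have h1 : Summable fun ℓ => ‖a ℓ * ζ ^ ℓ‖ := by rw [hn]; exact ha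
      have h2 : Summable fun ℓ => ‖b ℓ * ζ ^ ℓ‖ := by rw [hn]; exact hb
      exact summable_mul_of_summable_norm (f := fun ℓ => a ℓ * ζ ^ ℓ) (g := fun ℓ => b ℓ * ζ ^ ℓ) h1 h2
    have h := hA.mul hB hs
    have h2 := e.hasSum_iff.2 h
    refine h2.prod_fiberwise (fun ℓ => ?_)
    have h3 := ((hrow ℓ).of_norm.hasSum).mul_right (ζ ^ ℓ)
    refine h3.congr_fun ?_
    intro ℓ'
    simp only [e, Function.comp, Equiv.coe_fn_mk]
    rw [show ζ ^ ℓ = ζ ^ (ℓ - ℓ') * ζ ^ ℓ' by rw [← zpow_add₀ hζ0]; simp]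
    ring

lemma iterConv_facts (a : ℤ → ℂ) (ha : Summable fun ℓ => ‖a ℓ‖) (F : ℂ → ℂ)
    (hF : ∀ ζ : ℂ, ‖ζ‖ = 1 → HasSum (fun ℓ : ℤ => a ℓ * ζ ^ ℓ) (F ζ)) (n : ℕ) :
    (Summable fun ℓ => ‖iterConv a n ℓ‖) ∧ ∀ ζ : ℂ, ‖ζ‖ = 1 →
      HasSum (fun ℓ => iterConv a n ℓ * ζ ^ ℓ) (F ζ ^ (n + 1)) := by
  induction n with
  | zero => exact ⟨ha, fun ζ hζ => by simpa [iterConv] using hF ζ hζ⟩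
  | succ n ih =>
    obtain ⟨h1, h2⟩ := conv_facts (iterConv a n) a ih.1 ha
    refine ⟨h1, fun ζ hζ => ?_⟩
    rw [pow_succ]
    exact h2 ζ _ _ hζ (ih.2 ζ hζ) (hF ζ hζ)

lemma fourier_coeff (b : ℤ → ℂ) (hb : Summable fun ℓ => ‖b ℓ‖) (G : ℂ → ℂ)
    (hG : ∀ ζ : ℂ, ‖ζ‖ = 1 → HasSum (fun ℓ : ℤ => b ℓ * ζ ^ ℓ) (G ζ)) (θ0 : ℝ) (ℓ : ℤ) :
    b ℓ = (1 / (2 * Real.pi : ℂ)) * ∫ x in θ0..(θ0 + 2 * Real.pi),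
      G (Complex.exp (I * (x : ℝ))) * Complex.exp (I * (x : ℝ)) ^ (-ℓ) := by
  have hnorm : ∀ x : ℝ, ‖Complex.exp (I * (x : ℝ))‖ = 1 := fun x => by
    rw [mul_comm]; exact Complex.norm_exp_ofReal_mul_I x
  let f : ℤ → C(ℝ, ℂ) := fun j => ⟨fun x => b j * Complex.exp (I * (x : ℝ)) ^ j *
      Complex.exp (I * (x : ℝ)) ^ (-ℓ), by
    have : ∀ (j : ℤ), Continuous fun x : ℝ => Complex.exp (I * (x : ℝ)) ^ j := by
      intro j
      simp_rw [← Complex.exp_int_mul]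
      fun_prop
    exact (continuous_const.mul (this j)).mul (this (-ℓ))⟩
  have hfe : ∀ j x, f j x = b j * Complex.exp (I * (x : ℝ)) ^ j * Complex.exp (I * (x : ℝ)) ^ (-ℓ) :=
    fun _ _ => rfl
  have hval : ∀ j, ∫ x in θ0..(θ0 + 2 * Real.pi), f j x = if j = ℓ then b ℓ * (2 * Real.pi) else 0 := by
    intro j
    have h0 : ∀ x : ℝ, f j x = b j * Complex.exp (((j - ℓ : ℤ) : ℂ) * I * x) := by
      intro x
      rw [hfe, mul_assoc, ← zpow_add₀ (Complex.exp_ne_zero _), ← Complex.exp_int_mul]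
      congr 2
      push_cast; ring
    simp_rw [h0]
    rw [intervalIntegral.integral_const_mul]
    split_ifs with h
    · subst h; simp
    · have hc : ((j - ℓ : ℤ) : ℂ) * I ≠ 0 := by
        refine mul_ne_zero ?_ I_ne_zero
        exact_mod_cast sub_ne_zero.2 h
      rw [integral_exp_mul_complex hc]
      have : cexp (((j - ℓ : ℤ) : ℂ) * I * ((θ0 + 2 * Real.pi : ℝ) : ℂ)) =
          cexp (((j - ℓ : ℤ) : ℂ) * I * (θ0 : ℂ)) := by
        rw [Complex.exp_eq_exp_iff_exists_int]
        exact ⟨j - ℓ, by push_cast; ring⟩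
      rw [this]; simp
  have hsum := intervalIntegral.hasSum_intervalIntegral_of_summable_norm (a := θ0)
    (b := θ0 + 2 * Real.pi) (f := f) (by
      refine Summable.of_nonneg_of_le (fun _ => norm_nonneg _) (fun j => ?_) hb
      refine (ContinuousMap.norm_le _ (norm_nonneg _)).2 fun x => ?_
      rw [ContinuousMap.restrict_apply, hfe, norm_mul, norm_mul, norm_zpow, norm_zpow, hnorm]
      simp)
  have h1 := hsum.unique (by simp_rw [hval]; exact hasSum_ite_eq ℓ _)
  have h2 : ∫ x in θ0..(θ0 + 2 * Real.pi), (∑' j, f j x) = ∫ x in θ0..(θ0 + 2 * Real.pi),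
      G (Complex.exp (I * (x : ℝ))) * Complex.exp (I * (x : ℝ)) ^ (-ℓ) := by
    congr 1
    ext x
    exact ((hG _ (hnorm x)).mul_right _).tsum_eq
  rw [← h2, h1]
  have := Real.pi_pos.ne'
  have : (Real.pi : ℂ) ≠ 0 := by exact_mod_cast this
  field_simp

open MeasureTheory in
lemma split_arcs (g : ℝ → ℂ) (hg : Continuous g) (K : ℕ) (θ : Fin K → ℝ) (u v δ : ℝ) (huv : u ≤ v)
    (hδ : 0 < δ) (h1 : ∀ k, u < θ k - δ ∧ θ k + δ < v)
    (h2 : ∀ j k, j ≠ k → 2 * δ < |θ j - θ k|) :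
    ∫ x in u..v, g x = ∑ k, (∫ x in (-δ)..δ, g (θ k + x)) +
      ∫ x in Set.Ioc u v \ ⋃ k, Set.Ioc (θ k - δ) (θ k + δ), g x := by
  have hitg : IntegrableOn g (Set.Ioc u v) := (hg.integrableOn_Icc).mono_set Set.Ioc_subset_Icc_self
  have hsub : (⋃ k, Set.Ioc (θ k - δ) (θ k + δ)) ⊆ Set.Ioc u v := by
    refine Set.iUnion_subset fun k x hx => ?_
    exact ⟨(h1 k).1.trans hx.1, hx.2.trans (h1 k).2.le⟩
  have hm : MeasurableSet (⋃ k, Set.Ioc (θ k - δ) (θ k + δ)) :=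
    MeasurableSet.iUnion fun k => measurableSet_Ioc
  rw [intervalIntegral.integral_of_le huv]
  rw [setIntegral_sdiff hm hitg hsub]
  rw [integral_iUnion_fintype (fun k => measurableSet_Ioc)]
  · have : ∀ k, ∫ x in (-δ)..δ, g (θ k + x) = ∫ x in Set.Ioc (θ k - δ) (θ k + δ), g x := by
      intro k
      rw [intervalIntegral.integral_comp_add_left, intervalIntegral.integral_of_le (by linarith)]
      rfl
    simp_rw [this]
    ring
  · intro j k hjk
    refine Set.disjoint_left.2 fun x hx hx' => ?_
    have := h2 j k hjk
    rcases lt_abs.1 this with h | h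
    · linarith [hx.1, hx.2, hx'.1, hx'.2]
    · linarith [hx.1, hx.2, hx'.1, hx'.2]
  · intro k
    exact hitg.mono_set ((Set.subset_iUnion (fun k => Set.Ioc (θ k - δ) (θ k + δ)) k).trans hsub)

lemma choose_angles (K : ℕ) (κ : Fin K → ℂ) (hκ : ∀ k, ‖κ k‖ = 1) (hinj : Function.Injective κ) :
    ∃ θ0 : ℝ, ∃ θ : Fin K → ℝ, Function.Injective θ ∧
      (∀ k, θ0 < θ k ∧ θ k < θ0 + 2 * Real.pi) ∧ ∀ k, Complex.exp (I * θ k) = κ k := by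
  have hpi := Real.pi_pos
  obtain ⟨t, ht, htn⟩ := (Set.Ioo_infinite (show -Real.pi < Real.pi by linarith)).exists_notMem_finset
    (Finset.univ.image fun k => Complex.arg (κ k))
  have htk : ∀ k, Complex.exp (I * t) ≠ κ k := by
    intro k hk
    apply htn
    refine Finset.mem_image.2 ⟨k, Finset.mem_univ _, ?_⟩
    rw [← hk, mul_comm, Complex.arg_exp_mul_I, toIocMod_eq_self]
    exact ⟨ht.1, by linarith [ht.2]⟩
  have hexp : ∀ k, Complex.exp (I * (toIocMod Real.two_pi_pos t (Complex.arg (κ k)) : ℝ)) = κ k := by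
    intro k
    conv_rhs => rw [← Complex.norm_mul_exp_arg_mul_I (κ k), hκ k]
    rw [Complex.ofReal_one, one_mul, Complex.exp_eq_exp_iff_exists_int]
    refine ⟨-toIocDiv Real.two_pi_pos t (Complex.arg (κ k)), ?_⟩
    rw [toIocMod]
    push_cast
    simp
    ring
  refine ⟨t, fun k => toIocMod Real.two_pi_pos t (Complex.arg (κ k)), ?_, fun k => ?_, hexp⟩
  · intro j k hjk
    apply hinj
    rw [← hexp j, ← hexp k]
    simp only at hjk
    rw [hjk]
  · have := toIocMod_mem_Ioc Real.two_pi_pos t (Complex.arg (κ k))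
    refine ⟨this.1, lt_of_le_of_ne this.2 fun h => htk k ?_⟩
    simp only at h
    rw [← hexp k, h, Complex.exp_eq_exp_iff_exists_int]
    exact ⟨-1, by push_cast; ring⟩

lemma rest_sup (f : ℝ → ℝ) (hf : Continuous f) (K : ℕ) (θ : Fin K → ℝ) (u v δ : ℝ)
    (hδ : 0 < δ) (hlt : ∀ x ∈ Set.Icc u v, (∀ k, x ≠ θ k) → f x < 1) :
    ∃ c : ℝ, 0 < c ∧ ∀ x ∈ Set.Ioc u v \ ⋃ k, Set.Ioc (θ k - δ) (θ k + δ), f x ≤ Real.exp (-c) := by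
  set S := Set.Icc u v \ ⋃ k, Set.Ioo (θ k - δ) (θ k + δ) with hS
  have hSc : IsCompact S := isCompact_Icc.diff (isOpen_iUnion fun k => isOpen_Ioo)
  have hsub : (Set.Ioc u v \ ⋃ k, Set.Ioc (θ k - δ) (θ k + δ)) ⊆ S := by
    refine Set.sdiff_subset_sdiff Set.Ioc_subset_Icc_self ?_
    exact Set.iUnion_mono fun k => Set.Ioo_subset_Ioc_self
  have hS1 : ∀ x ∈ S, f x < 1 := by
    intro x hx
    refine hlt x hx.1 fun k hk => hx.2 ?_
    refine Set.mem_iUnion.2 ⟨k, ?_⟩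
    rw [hk]; constructor <;> linarith
  obtain ⟨q, hq0, hq1, hq⟩ : ∃ q : ℝ, 0 < q ∧ q < 1 ∧ ∀ x ∈ S, f x ≤ q := by
    rcases S.eq_empty_or_nonempty with h | h
    · exact ⟨1 / 2, by norm_num, by norm_num, by simp [h]⟩
    · obtain ⟨x0, hx0, hmax⟩ := hSc.exists_isMaxOn h hf.continuousOn
      refine ⟨max (f x0) (1 / 2), by positivity, max_lt (hS1 _ hx0) (by norm_num), fun x hx => ?_⟩
      exact (hmax hx).trans (le_max_left _ _)
  refine ⟨-Real.log q, by linarith [Real.log_neg hq0 hq1], fun x hx => ?_⟩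
  rw [neg_neg, Real.exp_log hq0]
  exact hq x (hsub hx)

/-- Complete asymptotic expansion of the iterated convolutions `a^{⋆n}_ℓ`, valid for all
`ℓ ∈ ℤ` and `n ≥ 1`, with an exponentially small error plus a generalized Gaussian
remainder bound. -/
theorem local_limit_expansion_global
    (a : ℤ → ℂ) (ha : Summable fun ℓ : ℤ => ‖a ℓ‖)
    (ε : ℝ) (hε : 0 < ε) (F : ℂ → ℂ)
    (hFsum : ∀ ζ : ℂ, 1 - ε < ‖ζ‖ → ‖ζ‖ < 1 + ε →
      HasSum (fun ℓ : ℤ => a ℓ * ζ ^ ℓ) (F ζ))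
    (hFhol : DifferentiableOn ℂ F {ζ : ℂ | 1 - ε < ‖ζ‖ ∧ ‖ζ‖ < 1 + ε})
    (hFsup : IsLUB {y : ℝ | ∃ κ : ℂ, ‖κ‖ = 1 ∧ y = ‖F κ‖} 1)
    (K : ℕ) (hK : 1 ≤ K) (κ : Fin K → ℂ) (hκinj : Function.Injective κ)
    (hκmod : ∀ k, ‖κ k‖ = 1)
    (hκtang : ∀ k, ‖F (κ k)‖ = 1)
    (hlt : ∀ z : ℂ, ‖z‖ = 1 → (∀ k, z ≠ κ k) → ‖F z‖ < 1)
    (α : Fin K → ℝ) (β : Fin K → ℂ) (hβ : ∀ k, 0 < (β k).re)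
    (μ : Fin K → ℕ) (hμ : ∀ k, 1 ≤ μ k)
    (γ : Fin K → ℕ → ℂ) (hγlow : ∀ k, ∀ ν : ℕ, ν < 2 * μ k + 1 → γ k ν = 0)
    (hexp : ∀ k, ∃ ρ : ℝ, 0 < ρ ∧ ∀ ξ : ℂ, ‖ξ‖ < ρ → ∃ s : ℂ,
      HasSum (fun ν : ℕ => γ k ν * (Complex.I * ξ) ^ ν / (Nat.factorial ν : ℂ)) s ∧
      F (κ k * Complex.exp (Complex.I * ξ)) =
        F (κ k) * Complex.exp (Complex.I * (α k) * ξ - β k * ξ ^ (2 * μ k) + s)) :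
    ∀ M : ℕ, ∃ C : ℝ, 0 < C ∧ ∃ c : ℝ, 0 < c ∧
      ∀ n : ℕ, 1 ≤ n → ∀ ℓ : ℤ,
        ‖iterConv a (n - 1) ℓ -
            ∑ k : Fin K, ∑ m ∈ Finset.range (M + 1),
              κ k ^ (-ℓ) * F (κ k) ^ n *
                (((n : ℝ) ^ (-((m : ℝ) + 1) / (2 * (μ k : ℝ))) : ℝ) : ℂ) *
                PdiffH (μ k) (γ k) m (Hfun (μ k) (β k))
                  (((ℓ : ℝ) - α k * n) / (n : ℝ) ^ ((1 : ℝ) / (2 * (μ k : ℝ))))‖ ≤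
          C * Real.exp (-c * n) + C * ∑ k : Fin K,
            (n : ℝ) ^ (-((M : ℝ) + 2) / (2 * (μ k : ℝ))) *
              Real.exp (-c *
                (|(ℓ : ℝ) - α k * n| / (n : ℝ) ^ ((1 : ℝ) / (2 * (μ k : ℝ)))) ^
                  ((2 * (μ k : ℝ)) / (2 * (μ k : ℝ) - 1))) := by
  intro M
  have hpi := Real.pi_pos
  have hF1 : ∀ ζ : ℂ, ‖ζ‖ = 1 → HasSum (fun ℓ : ℤ => a ℓ * ζ ^ ℓ) (F ζ) :=
    fun ζ hζ => hFsum ζ (by linarith) (by linarith)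
  have hnorm : ∀ x : ℝ, ‖Complex.exp (I * (x : ℝ))‖ = 1 := fun x => by
    rw [mul_comm]; exact Complex.norm_exp_ofReal_mul_I x
  have hFc : Continuous fun x : ℝ => F (Complex.exp (I * (x : ℝ))) := by
    refine hFhol.continuousOn.comp_continuous (by fun_prop) fun x => ?_
    have := hnorm x
    constructor <;> linarith
  obtain ⟨θ0, θ, hθinj, hθ, hθκ⟩ := choose_angles K κ hκmod hκinj
  choose δ0 hδ0 harc using fun k => arc_lemma F (κ k) (hκmod k) (hκtang k) (α k) (μ k) (hμ k) (β k)
    (hβ k) (γ k) (hγlow k) (hexp k) M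
  obtain ⟨δ, hδ, hδk, hδs⟩ : ∃ δ : ℝ, 0 < δ ∧ (∀ k, δ ≤ δ0 k ∧ θ0 < θ k - δ ∧
      θ k + δ < θ0 + 2 * Real.pi) ∧ ∀ j k, j ≠ k → 2 * δ < |θ j - θ k| := by
    have hev : ∀ r : ℝ, 0 < r → ∀ᶠ δ in nhdsWithin (0:ℝ) (Set.Ioi 0), δ < r := fun r hr =>
      nhdsWithin_le_nhds (eventually_lt_nhds hr)
    have e1 : ∀ᶠ δ in nhdsWithin (0:ℝ) (Set.Ioi 0), ∀ k, δ ≤ δ0 k ∧ θ0 < θ k - δ ∧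
      θ k + δ < θ0 + 2 * Real.pi := by
      refine Filter.eventually_all.2 fun k => ?_
      filter_upwards [hev _ (hδ0 k), hev _ (sub_pos.2 (hθ k).1), hev _ (sub_pos.2 (hθ k).2)]
        with δ h1 h2 h3
      refine ⟨h1.le, by linarith, by linarith⟩
    have e2 : ∀ᶠ δ in nhdsWithin (0:ℝ) (Set.Ioi 0), ∀ j k, j ≠ k → 2 * δ < |θ j - θ k| := by
      refine Filter.eventually_all.2 fun j => Filter.eventually_all.2 fun k => ?_
      by_cases hjk : j = k
      · simp [hjk]
      · have : 0 < |θ j - θ k| / 2 := by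
          have := abs_pos.2 (sub_ne_zero.2 (hθinj.ne hjk))
          linarith
        filter_upwards [hev _ this] with δ h1 _
        linarith
    obtain ⟨δ, h1, h2, h3⟩ := (Filter.Eventually.and (self_mem_nhdsWithin : Set.Ioi (0:ℝ) ∈ nhdsWithin (0:ℝ) (Set.Ioi 0))
      (e1.and e2)).exists
    exact ⟨δ, h1, h2, h3⟩
  choose Ck hCk ck hck hk using fun k => harc k δ hδ (hδk k).1
  obtain ⟨c', hc', hrest⟩ := rest_sup (fun x : ℝ => ‖F (Complex.exp (I * (x : ℝ)))‖) hFc.norm K θ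
    θ0 (θ0 + 2 * Real.pi) δ hδ (by
      intro x hx hxk
      refine hlt _ (hnorm x) fun k hk => hxk k ?_
      rw [← hθκ k, Complex.exp_eq_exp_iff_exists_int] at hk
      obtain ⟨m, hm⟩ := hk
      have hm2 : x = θ k + m * (2 * Real.pi) := by
        have h3 : I * (x : ℂ) = I * ((θ k + m * (2 * Real.pi) : ℝ) : ℂ) := by
          rw [hm]; push_cast; ring
        exact_mod_cast mul_left_cancel₀ I_ne_zero h3
      have hm1 : (m : ℝ) < 1 := by
        by_contra h
        have : (1:ℝ) ≤ m := not_lt.1 h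
        nlinarith [hx.1, hx.2, (hθ k).1, (hθ k).2]
      have hm3 : (-1 : ℝ) < m := by
        by_contra h
        have : (m:ℝ) ≤ -1 := not_lt.1 h
        nlinarith [hx.1, hx.2, (hθ k).1, (hθ k).2]
      have hm0 : m = 0 := by
        have h1 : m < 1 := by exact_mod_cast hm1
        have h2 : -1 < m := by exact_mod_cast hm3
        omega
      rw [hm2, hm0]; simp)
  obtain ⟨c, hc, hcc', hcck⟩ : ∃ c : ℝ, 0 < c ∧ c ≤ c' ∧ ∀ k, c ≤ ck k := by
    have hev : ∀ r : ℝ, 0 < r → ∀ᶠ δ in nhdsWithin (0:ℝ) (Set.Ioi 0), δ ≤ r := fun r hr =>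
      nhdsWithin_le_nhds (eventually_le_nhds hr)
    obtain ⟨c, h1, h2, h3⟩ := (Filter.Eventually.and
      (self_mem_nhdsWithin : Set.Ioi (0:ℝ) ∈ nhdsWithin (0:ℝ) (Set.Ioi 0)) ((hev _ hc').and
      (Filter.eventually_all.2 fun k => hev _ (hck k)))).exists
    exact ⟨c, h1, h2, h3⟩
  have hSC : ∀ k, Ck k ≤ ∑ j, Ck j := fun k =>
    Finset.single_le_sum (fun j _ => (hCk j).le) (Finset.mem_univ k)
  have hSC0 : 0 ≤ ∑ j, Ck j := Finset.sum_nonneg fun j _ => (hCk j).le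
  refine ⟨1 + ∑ k, Ck k, by linarith, c, hc, fun n hn ℓ => ?_⟩
  have hn0 : (0:ℝ) ≤ n := Nat.cast_nonneg n
  obtain ⟨hb, hbs⟩ := iterConv_facts a ha F hF1 (n - 1)
  rw [Nat.sub_add_cancel hn] at hbs
  rw [fourier_coeff (iterConv a (n - 1)) hb (fun ζ => F ζ ^ n) hbs θ0 ℓ]
  set g : ℝ → ℂ := fun x => F (Complex.exp (I * (x : ℝ))) ^ n * Complex.exp (I * (x : ℝ)) ^ (-ℓ) with hg
  have hgc : Continuous g := by
    refine (hFc.pow n).mul ?_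
    simp_rw [← Complex.exp_int_mul]
    fun_prop
  rw [split_arcs g hgc K θ θ0 (θ0 + 2 * Real.pi) δ (by linarith) hδ (fun k => (hδk k).2) hδs]
  set D := Set.Ioc θ0 (θ0 + 2 * Real.pi) \ ⋃ k, Set.Ioc (θ k - δ) (θ k + δ) with hD
  have hDle : MeasureTheory.volume.real D ≤ 2 * Real.pi := by
    have h := MeasureTheory.measureReal_mono (μ := MeasureTheory.volume)
      (Set.sdiff_subset : D ⊆ Set.Ioc θ0 (θ0 + 2 * Real.pi)) measure_Ioc_lt_top.ne
    rw [Real.volume_real_Ioc_of_le (by linarith)] at h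
    linarith
  have hDb : ‖∫ x in D, g x‖ ≤ Real.exp (-c * n) * (2 * Real.pi) := by
    have hlt : MeasureTheory.volume D < ⊤ :=
      (MeasureTheory.measure_mono (Set.sdiff_subset : D ⊆ Set.Ioc θ0 (θ0 + 2 * Real.pi))).trans_lt
        measure_Ioc_lt_top
    refine (MeasureTheory.norm_setIntegral_le_of_norm_le_const hlt (C := Real.exp (-c * n)) ?_).trans
      (by gcongr)
    intro x hx
    have h1 := hrest x hx
    simp only [hg]
    rw [norm_mul, norm_zpow, hnorm, one_zpow, mul_one, norm_pow]
    calc _ ≤ Real.exp (-c') ^ n := by gcongr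
      _ = Real.exp (-c' * n) := by rw [← Real.exp_nat_mul]; congr 1; ring
      _ ≤ _ := by gcongr
  have harcs : ∀ k, ∫ x in (-δ)..δ, g (θ k + x) = ∫ x in (-δ)..δ, F (κ k * Complex.exp (I * (x : ℝ))) ^ n *
          (κ k * Complex.exp (I * (x : ℝ))) ^ (-ℓ) := by
    intro k
    congr 1
    ext x
    simp only [hg]
    rw [← hθκ k, ← Complex.exp_add]
    congr 4 <;> push_cast <;> ring
  simp_rw [harcs]
  set V : Fin K → ℂ := fun k => ∫ x in (-δ)..δ, F (κ k * Complex.exp (I * (x : ℝ))) ^ n *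
          (κ k * Complex.exp (I * (x : ℝ))) ^ (-ℓ) with hV
  have hreg : ∀ (W : Fin K → ℂ) (r : ℂ), (1 / (2 * Real.pi : ℂ)) * (∑ k, V k + r) - ∑ k, W k =
      ∑ k, ((1 / (2 * Real.pi : ℂ)) * V k - W k) + (1 / (2 * Real.pi : ℂ)) * r := by
    intro W r
    rw [Finset.sum_sub_distrib, mul_add, Finset.mul_sum]
    ring
  rw [hreg]
  have hrestb : ‖(1 / (2 * Real.pi : ℂ)) * ∫ x in D, g x‖ ≤ Real.exp (-c * n) := by
    rw [norm_mul, show ‖(1 / (2 * Real.pi : ℂ))‖ = 1 / (2 * Real.pi) by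
      simp [abs_of_pos hpi]]
    calc _ ≤ 1 / (2 * Real.pi) * (Real.exp (-c * n) * (2 * Real.pi)) := by gcongr
      _ = _ := by field_simp
  set T : Fin K → ℝ := fun k => (n : ℝ) ^ (-((M : ℝ) + 2) / (2 * (μ k : ℝ))) *
              Real.exp (-c *
                (|(ℓ : ℝ) - α k * n| / (n : ℝ) ^ ((1 : ℝ) / (2 * (μ k : ℝ)))) ^
                  ((2 * (μ k : ℝ)) / (2 * (μ k : ℝ) - 1))) with hT
  have hT0 : ∀ k, 0 ≤ T k := fun k => by positivity
  have hmain := fun k => (hk k n hn ℓ).trans (show _ ≤ Ck k * Real.exp (-c * n) + (∑ j, Ck j) * T k by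
    have h1 := hcck k
    have h2 := (hCk k).le
    have h3 := hSC k
    simp only [hT]
    gcongr)
  refine (norm_add_le _ _).trans ?_
  refine (add_le_add ((norm_sum_le _ _).trans (Finset.sum_le_sum fun k _ => hmain k)) hrestb).trans ?_
  rw [Finset.sum_add_distrib, ← Finset.sum_mul, ← Finset.mul_sum]
  have h5 : 0 ≤ ∑ k, T k := Finset.sum_nonneg fun k _ => hT0 k
  linarith
end

section
/- There exists δ₀ > 0 such that for every δ ∈ (0, δ₀] there exists c > 0 with the following property: for every n ∈ ℕ* and every ℓ ∈ ℤ, | a^{⋆n}_ℓ − Σ_{k=1}^{K} (κ_k^{−ℓ} F_a(κ_k)^n / 2π) ∫_{−δ}^{δ} e^{−iℓθ} ( F_a(κ_k)^{−1} F_a(κ_k e^{iθ}) )^n dθ | ≤ e^{−c n}. -/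
open Complex

theorem aux_conv {f g : ℤ → ℂ} (hf : Summable fun l => ‖f l‖) (hg : Summable fun l => ‖g l‖) :
    (Summable fun l => ‖conv f g l‖) ∧
      HasSum (conv f g) ((∑' l, f l) * ∑' l, g l) := by
  let e : ℤ × ℤ ≃ ℤ × ℤ :=
    { toFun := fun p => (p.1 - p.2, p.2)
      invFun := fun p => (p.1 + p.2, p.2)
      left_inv := fun p => by simp
      right_inv := fun p => by simp }
  have h1 : Summable fun p : ℤ × ℤ => ‖f (p.1 - p.2) * g p.2‖ :=
    (e.summable_iff (f := fun p : ℤ × ℤ => ‖f p.1 * g p.2‖)).2 (hf.mul_norm hg)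
  have h2 : HasSum (fun p : ℤ × ℤ => f (p.1 - p.2) * g p.2) ((∑' l, f l) * ∑' l, g l) := by
    rw [tsum_mul_tsum_of_summable_norm hf hg]
    exact (e.hasSum_iff (f := fun p : ℤ × ℤ => f p.1 * g p.2)).2
      (summable_mul_of_summable_norm hf hg).hasSum
  constructor
  · refine Summable.of_nonneg_of_le (fun _ => norm_nonneg _) (fun l => ?_) h1.prod
    exact norm_tsum_le_tsum_norm (h1.prod_factor l)
  · exact h2.prod_fiberwise fun l => (h1.prod_factor l).of_norm.hasSum

theorem aux_conv_mul {f g : ℤ → ℂ} (hf : Summable fun l => ‖f l‖) (hg : Summable fun l => ‖g l‖)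
    {z A B : ℂ} (hz : ‖z‖ = 1) (hA : HasSum (fun l => f l * z ^ l) A)
    (hB : HasSum (fun l => g l * z ^ l) B) :
    HasSum (fun l => conv f g l * z ^ l) (A * B) := by
  have hz0 : z ≠ 0 := by
    intro h
    simp [h] at hz
  have h := (aux_conv (f := fun l => f l * z ^ l) (g := fun l => g l * z ^ l)
    (by simpa [hz] using hf) (by simpa [hz] using hg)).2
  rw [hA.tsum_eq, hB.tsum_eq] at h
  convert h using 2 with l
  simp only [conv]
  rw [← tsum_mul_right]
  refine tsum_congr fun m => ?_
  rw [zpow_sub₀ hz0]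
  have : z ^ m ≠ 0 := zpow_ne_zero _ hz0
  field_simp

theorem aux_iter {a : ℤ → ℂ} (ha : Summable fun l => ‖a l‖) (n : ℕ) :
    (Summable fun l => ‖iterConv a n l‖) ∧ ∀ z A : ℂ, ‖z‖ = 1 →
      HasSum (fun l => a l * z ^ l) A → HasSum (fun l => iterConv a n l * z ^ l) (A ^ (n + 1)) := by
  induction n with
  | zero => exact ⟨ha, fun z A _ h => by simpa [iterConv] using h⟩
  | succ n ih =>
    refine ⟨(aux_conv ih.1 ha).1, fun z A hz h => ?_⟩
    rw [pow_succ]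
    exact aux_conv_mul ih.1 ha hz (ih.2 z A hz h) h

theorem aux_exp_int (b : ℝ) (m : ℤ) (hm : m ≠ 0) :
    ∫ θ in b..(b + 2 * Real.pi), Complex.exp ((Complex.I * m) * (θ : ℝ)) = 0 := by
  rw [integral_exp_mul_complex (by simp [hm])]
  have : Complex.I * m * ((b + 2 * Real.pi : ℝ) : ℂ)
      = Complex.I * m * b + m * (2 * Real.pi * Complex.I) := by
    push_cast
    ring
  rw [this, Complex.exp_add, Complex.exp_int_mul_two_pi_mul_I]
  simp

theorem aux_coeff {c : ℤ → ℂ} (hc : Summable fun l => ‖c l‖) {S : ℝ → ℂ}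
    (hS : ∀ θ : ℝ, HasSum (fun m : ℤ => c m * Complex.exp (Complex.I * θ) ^ m) (S θ))
    (b : ℝ) (l : ℤ) :
    ∫ θ in b..(b + 2 * Real.pi), Complex.exp (-Complex.I * l * (θ : ℝ)) * S θ
      = 2 * Real.pi * c l := by
  have key : ∀ (m : ℤ) (θ : ℝ), Complex.exp (-Complex.I * l * θ) *
      (c m * Complex.exp (Complex.I * θ) ^ m)
      = c m * Complex.exp ((Complex.I * (m - l : ℤ)) * θ) := by
    intro m θ
    rw [← Complex.exp_int_mul, mul_left_comm, ← Complex.exp_add]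
    push_cast
    ring_nf
  have h1 : HasSum (fun m : ℤ => ∫ θ in b..(b + 2 * Real.pi),
      c m * Complex.exp ((Complex.I * (m - l : ℤ)) * (θ : ℝ)))
      (∫ θ in b..(b + 2 * Real.pi), Complex.exp (-Complex.I * l * (θ : ℝ)) * S θ) := by
    refine intervalIntegral.hasSum_integral_of_dominated_convergence
      (fun m _ => ‖c m‖) (fun m => ?_) (fun m => ?_) ?_ ?_ ?_
    · exact (by fun_prop : Continuous fun θ : ℝ =>
        c m * Complex.exp ((Complex.I * (m - l : ℤ)) * (θ : ℝ))).aestronglyMeasurable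
    · refine Filter.Eventually.of_forall fun θ _ => ?_
      rw [norm_mul, Complex.norm_exp]
      simp
    · exact Filter.Eventually.of_forall fun θ _ => hc
    · simp
    · refine Filter.Eventually.of_forall fun θ _ => ?_
      have := (hS θ).mul_left (Complex.exp (-Complex.I * l * (θ : ℝ)))
      simpa only [key] using this
  have h2 : HasSum (fun m : ℤ => ∫ θ in b..(b + 2 * Real.pi),
      c m * Complex.exp ((Complex.I * (m - l : ℤ)) * (θ : ℝ))) (2 * Real.pi * c l) := by
    have h3 := hasSum_single (f := fun m : ℤ => ∫ θ in b..(b + 2 * Real.pi),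
      c m * Complex.exp ((Complex.I * (m - l : ℤ)) * (θ : ℝ))) l (fun m hm => by
        rw [intervalIntegral.integral_const_mul, aux_exp_int b (m - l) (sub_ne_zero.2 hm),
          mul_zero])
    convert h3 using 1
    simp
  exact h1.unique h2

/-- Localization of the iterated convolution at the tangency points: up to an
exponentially small error, `a^{⋆n}_ℓ` is the sum of the local oscillatory integrals
near each tangency point `κ_k`. -/
theorem localization_at_tangency_points
    (a : ℤ → ℂ) (ha : Summable fun ℓ : ℤ => ‖a ℓ‖)
    (ε : ℝ) (hε : 0 < ε) (F : ℂ → ℂ)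
    (hFsum : ∀ ζ : ℂ, 1 - ε < ‖ζ‖ → ‖ζ‖ < 1 + ε →
      HasSum (fun ℓ : ℤ => a ℓ * ζ ^ ℓ) (F ζ))
    (hFhol : DifferentiableOn ℂ F {ζ : ℂ | 1 - ε < ‖ζ‖ ∧ ‖ζ‖ < 1 + ε})
    (hFsup : IsLUB {y : ℝ | ∃ κ : ℂ, ‖κ‖ = 1 ∧ y = ‖F κ‖} 1)
    (K : ℕ) (hK : 1 ≤ K) (κ : Fin K → ℂ) (hκinj : Function.Injective κ)
    (hκmod : ∀ k, ‖κ k‖ = 1)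
    (hκtang : ∀ k, ‖F (κ k)‖ = 1)
    (hlt : ∀ z : ℂ, ‖z‖ = 1 → (∀ k, z ≠ κ k) → ‖F z‖ < 1) :
    ∃ δ₀ : ℝ, 0 < δ₀ ∧ ∀ δ : ℝ, 0 < δ → δ ≤ δ₀ →
      ∃ c : ℝ, 0 < c ∧ ∀ n : ℕ, 1 ≤ n → ∀ ℓ : ℤ,
        ‖(iterConv a (n - 1) ℓ -
            ∑ k : Fin K, κ k ^ (-ℓ) * F (κ k) ^ n / (2 * Real.pi) *
              ∫ θ in (-δ)..δ, Complex.exp (-Complex.I * ℓ * θ) *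
                ((F (κ k))⁻¹ * F (κ k * Complex.exp (Complex.I * θ))) ^ n)‖ ≤
          Real.exp (-c * n) := by
  have hnorm : ∀ θ : ℝ, ‖Complex.exp (Complex.I * θ)‖ = 1 := fun θ => by
    rw [mul_comm]
    exact Complex.norm_exp_ofReal_mul_I θ
  have hFs : ∀ z : ℂ, ‖z‖ = 1 → HasSum (fun l : ℤ => a l * z ^ l) (F z) := fun z hz =>
    hFsum z (by linarith) (by linarith)
  have hFc : Continuous fun θ : ℝ => F (Complex.exp (Complex.I * θ)) := by
    rw [continuous_iff_continuousAt]
    intro θ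
    have h1 : ContinuousAt F (Complex.exp (Complex.I * θ)) := by
      refine (hFhol.differentiableAt (IsOpen.mem_nhds ?_ ?_)).continuousAt
      · exact (isOpen_lt continuous_const continuous_norm).inter
          (isOpen_lt continuous_norm continuous_const)
      · constructor <;> rw [hnorm θ] <;> linarith
    exact ContinuousAt.comp (f := fun θ : ℝ => Complex.exp (Complex.I * θ)) h1
      (by fun_prop)
  set t : Fin K → ℝ := fun k => Complex.arg (κ k) with ht
  have hκt : ∀ k, κ k = Complex.exp (Complex.I * t k) := fun k => by
    have := Complex.norm_mul_exp_arg_mul_I (κ k)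
    rw [hκmod k] at this
    rw [mul_comm, ← this]
    simp [ht]
  have htinj : Function.Injective t := fun j k h => hκinj (by rw [hκt j, hκt k, h])
  have ht1 : ∀ k, -Real.pi < t k := fun k => Complex.neg_pi_lt_arg _
  have ht2 : ∀ k, t k ≤ Real.pi := fun k => Complex.arg_le_pi _
  obtain ⟨η, ⟨hη1, hη2⟩, hη⟩ : ∃ η : ℝ, ((∀ k, 2 * η < t k + Real.pi) ∧
      ∀ j k, j ≠ k → 2 * η < |t j - t k|) ∧ 0 < η := by
    have hev : ∀ x : ℝ, 0 < x → ∀ᶠ η in nhdsWithin (0 : ℝ) (Set.Ioi 0), 2 * η < x := by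
      intro x hx
      filter_upwards [Ioo_mem_nhdsGT (show (0 : ℝ) < x / 2 by positivity)] with η h
      linarith [h.2]
    have h1 : ∀ᶠ η in nhdsWithin (0 : ℝ) (Set.Ioi 0), ∀ k, 2 * η < t k + Real.pi :=
      Filter.eventually_all.2 fun k => hev _ (by linarith [ht1 k])
    have h2 : ∀ᶠ η in nhdsWithin (0 : ℝ) (Set.Ioi 0), ∀ j k, j ≠ k → 2 * η < |t j - t k| :=
      Filter.eventually_all.2 fun j => Filter.eventually_all.2 fun k => by
        by_cases hjk : j = k
        · simp [hjk]
        · filter_upwards [hev _ (abs_pos.2 (sub_ne_zero.2 (htinj.ne hjk)))] with η h _ using h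
    exact ((h1.and h2).and self_mem_nhdsWithin).exists
  refine ⟨η, hη, fun δ hδ hδη => ?_⟩
  set b : ℝ := -Real.pi + η with hb
  -- the sets
  set A : Fin K → Set ℝ := fun k => Set.Ioc (t k - δ) (t k + δ) with hA
  set J : Set ℝ := Set.Ioc b (b + 2 * Real.pi) with hJ
  have hAJ : ∀ k, A k ⊆ J := fun k x hx => by
    have := hη1 k
    have := ht2 k
    exact ⟨by linarith [hx.1], by linarith [hx.2]⟩
  have hAd : Set.Pairwise (↑(Finset.univ : Finset (Fin K))) (Function.onFun Disjoint A) := by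
    intro j _ k _ hjk
    refine Set.disjoint_left.2 fun x hx hy => ?_
    have := hη2 j k hjk
    rcases lt_abs.1 this with h | h <;> linarith [hx.1, hx.2, hy.1, hy.2]
  -- uniform bound
  obtain ⟨c, hc, hbound⟩ : ∃ c : ℝ, 0 < c ∧ ∀ θ ∈ J \ ⋃ k ∈ (Finset.univ : Finset (Fin K)), A k,
      ‖F (Complex.exp (Complex.I * θ))‖ ≤ Real.exp (-c) := by
    have hcpt : IsCompact (Set.Icc b (b + 2 * Real.pi) \ ⋃ k, Set.Ioo (t k - δ) (t k + δ)) :=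
      isCompact_Icc.diff (isOpen_iUnion fun k => isOpen_Ioo)
    have hsub : J \ (⋃ k ∈ (Finset.univ : Finset (Fin K)), A k) ⊆
        Set.Icc b (b + 2 * Real.pi) \ ⋃ k, Set.Ioo (t k - δ) (t k + δ) := by
      rintro x ⟨hx, hx'⟩
      refine ⟨Set.Ioc_subset_Icc_self hx, fun h => hx' ?_⟩
      obtain ⟨k, hk⟩ := Set.mem_iUnion.1 h
      simp only [Finset.mem_univ, Set.iUnion_true]
      exact Set.mem_iUnion.2 ⟨k, Set.Ioo_subset_Ioc_self hk⟩
    rcases Set.eq_empty_or_nonempty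
      (Set.Icc b (b + 2 * Real.pi) \ ⋃ k, Set.Ioo (t k - δ) (t k + δ)) with he | hne
    · refine ⟨1, one_pos, fun θ hθ => ?_⟩
      have := hsub hθ
      rw [he] at this
      exact this.elim
    · obtain ⟨x, hx, hmax⟩ := hcpt.exists_isMaxOn hne hFc.norm.continuousOn
      have hx1 : ‖F (Complex.exp (Complex.I * x))‖ < 1 := by
        refine hlt _ (hnorm x) fun k hk => ?_
        rw [hκt k] at hk
        obtain ⟨m, hm⟩ := Complex.exp_eq_exp_iff_exists_int.1 hk
        have hm' : x = t k + m * (2 * Real.pi) := by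
          have := congrArg Complex.im hm
          simpa using this
        have hk1 := hη1 k
        have hk2 := ht2 k
        have hpi := Real.pi_pos
        have hm0 : m = 0 := by
          have h1 : (m : ℝ) < 1 := by
            by_contra! h
            nlinarith [hx.1.2]
          have h2 : (-1 : ℝ) < m := by
            by_contra! h
            nlinarith [hx.1.1]
          have h1' : m < 1 := by exact_mod_cast h1
          have h2' : -1 < m := by exact_mod_cast h2
          omega
        rw [hm0] at hm'
        refine hx.2 (Set.mem_iUnion.2 ⟨k, ?_⟩)
        rw [hm']
        constructor <;> simp [hδ]
      obtain ⟨r, hr1, hr2⟩ := exists_between hx1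
      have hr0 : 0 < r := lt_of_le_of_lt (norm_nonneg _) hr1
      refine ⟨-Real.log r, by linarith [Real.log_neg hr0 hr2], fun θ hθ => ?_⟩
      rw [neg_neg, Real.exp_log hr0]
      exact (hmax (hsub hθ)).trans hr1.le
  refine ⟨c, hc, fun n hn ℓ => ?_⟩
  set G : ℝ → ℂ := fun θ => Complex.exp (-Complex.I * ℓ * θ) *
    F (Complex.exp (Complex.I * θ)) ^ n with hG
  have hGc : Continuous G := by
    have := hFc.pow n
    exact Continuous.mul (by fun_prop) this
  have hGnorm : ∀ θ, ‖G θ‖ = ‖F (Complex.exp (Complex.I * θ))‖ ^ n := fun θ => by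
    simp only [hG]
    rw [norm_mul, norm_pow, Complex.norm_exp]
    simp
  have hpi := Real.pi_pos
  have hfull : iterConv a (n - 1) ℓ = (2 * Real.pi : ℂ)⁻¹ * ∫ θ in J, G θ := by
    have h := aux_coeff (aux_iter ha (n - 1)).1
      (S := fun θ => F (Complex.exp (Complex.I * θ)) ^ n) (fun θ => by
        have := (aux_iter ha (n - 1)).2 _ _ (hnorm θ) (hFs _ (hnorm θ))
        rwa [Nat.sub_add_cancel hn] at this) b ℓ
    rw [intervalIntegral.integral_of_le (by linarith)] at h
    have h0 : (2 * Real.pi : ℂ) ≠ 0 := by simp [hpi.ne']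
    rw [hJ, hG, h, inv_mul_cancel_left₀ h0]
  have hterm : ∀ k, κ k ^ (-ℓ) * F (κ k) ^ n / (2 * Real.pi) *
      ∫ θ in (-δ)..δ, Complex.exp (-Complex.I * ℓ * θ) *
        ((F (κ k))⁻¹ * F (κ k * Complex.exp (Complex.I * θ))) ^ n
      = (2 * Real.pi : ℂ)⁻¹ * ∫ θ in A k, G θ := by
    intro k
    have hFk : F (κ k) ≠ 0 := by
      intro h
      have := hκtang k
      simp [h] at this
    have h1 : ∫ θ in A k, G θ = ∫ θ in (-δ)..δ, G (t k + θ) := by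
      rw [intervalIntegral.integral_comp_add_left, intervalIntegral.integral_of_le (by linarith)]
      rfl
    rw [h1, div_eq_mul_inv, mul_comm _ (2 * Real.pi : ℂ)⁻¹, mul_assoc,
      ← intervalIntegral.integral_const_mul]
    congr 1
    refine intervalIntegral.integral_congr fun θ _ => ?_
    simp only [hG]
    have e1 : Complex.exp (Complex.I * ((t k + θ : ℝ) : ℂ)) =
        κ k * Complex.exp (Complex.I * θ) := by
      rw [hκt k, ← Complex.exp_add]
      push_cast
      ring_nf
    have e2 : Complex.exp (-Complex.I * ℓ * ((t k + θ : ℝ) : ℂ)) =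
        κ k ^ (-ℓ) * Complex.exp (-Complex.I * ℓ * θ) := by
      rw [hκt k, ← Complex.exp_int_mul, ← Complex.exp_add]
      push_cast
      ring_nf
    rw [e1, e2, mul_pow, inv_pow]
    have : F (κ k) ^ n ≠ 0 := pow_ne_zero _ hFk
    field_simp
  have hAm : MeasurableSet (⋃ k ∈ (Finset.univ : Finset (Fin K)), A k) :=
    Finset.measurableSet_biUnion _ fun k _ => measurableSet_Ioc
  have hGi : ∀ x y : ℝ, MeasureTheory.IntegrableOn G (Set.Ioc x y) := fun x y =>
    (hGc.integrableOn_Icc).mono_set Set.Ioc_subset_Icc_self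
  have hsplit := MeasureTheory.setIntegral_sdiff hAm (hGi b (b + 2 * Real.pi))
    (Set.iUnion₂_subset fun k _ => hAJ k)
  rw [MeasureTheory.integral_biUnion_finset _ (fun k _ => measurableSet_Ioc) hAd
    (fun k _ => hGi _ _)] at hsplit
  simp only [hterm]
  rw [hfull, ← Finset.mul_sum, ← mul_sub, ← hsplit]
  have hvol : MeasureTheory.volume J < ⊤ := measure_Ioc_lt_top
  have hle := MeasureTheory.norm_setIntegral_le_of_norm_le_const
    (μ := MeasureTheory.volume) (f := G) (C := Real.exp (-c) ^ n)
    (lt_of_le_of_lt (MeasureTheory.measure_mono Set.sdiff_subset) hvol)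
    (fun θ hθ => by
      rw [hGnorm]
      exact pow_le_pow_left₀ (norm_nonneg _) (hbound θ hθ) n)
  have hvol2 : MeasureTheory.volume.real (J \ ⋃ k ∈ (Finset.univ : Finset (Fin K)), A k)
      ≤ 2 * Real.pi := by
    refine (MeasureTheory.measureReal_mono Set.sdiff_subset hvol.ne).trans ?_
    simp [hJ, hpi.le]
  have hexp : Real.exp (-c * n) = Real.exp (-c) ^ n := by
    rw [mul_comm, Real.exp_nat_mul]
  rw [hexp, norm_mul]
  have hn2 : ‖(2 * Real.pi : ℂ)⁻¹‖ = (2 * Real.pi)⁻¹ := by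
    simp [abs_of_pos hpi]
  rw [hn2, inv_mul_le_iff₀ (by positivity)]
  refine hle.trans ?_
  rw [mul_comm]
  gcongr
end

section
/- Let μ ∈ ℕ* and β ∈ ℂ with Re β > 0. Then for every N ∈ ℕ there exists a constant C > 0 such that for every x ∈ ℝ, |H_{2μ}^β(x)| + |（H_{2μ}^β)'(x)| + … + |(H_{2μ}^β)^{(N)}(x)| ≤ C · exp( −(1/C) |x|^{2μ/(2μ−1)} ). -/
open Complex

lemma key_lower (n : ℕ) (hn : Even n) (hn2 : 2 ≤ n) (β : ℂ) (hβ : 0 < β.re) :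
    ∃ c K : ℝ, 0 < c ∧ 0 < K ∧ ∀ a b : ℝ,
      c * a ^ n - K * b ^ n ≤ (β * ((a : ℂ) + b * I) ^ n).re := by
  have hβn : 0 < ‖β‖ := lt_of_lt_of_le hβ (Complex.re_le_norm β)
  have hcont : ContinuousAt (fun t : ℝ => (β * (1 + (t : ℂ) * I) ^ n).re) 0 := by
    fun_prop
  have hev := hcont.eventually (lt_mem_nhds (a := β.re / 2) (by simp; linarith))
  obtain ⟨δ, hδ, hball⟩ := Metric.eventually_nhds_iff.1 hev
  refine ⟨β.re / 2, ‖β‖ * (2 / δ + 1) ^ n + β.re / 2 * (2 / δ) ^ n, by linarith, by positivity, ?_⟩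
  intro a b
  have han : 0 ≤ a ^ n := hn.pow_nonneg a
  have hbn : 0 ≤ b ^ n := hn.pow_nonneg b
  have hK : 0 ≤ ‖β‖ * (2 / δ + 1) ^ n + β.re / 2 * (2 / δ) ^ n := by positivity
  by_cases h : |a| ≤ 2 / δ * |b|
  · have h1 : ‖(a : ℂ) + b * I‖ ≤ (2 / δ + 1) * |b| := by
      calc ‖(a : ℂ) + b * I‖ ≤ ‖(a : ℂ)‖ + ‖(b : ℂ) * I‖ := norm_add_le _ _
        _ = |a| + |b| := by simp
        _ ≤ _ := by linarith
    have h2 : ‖β * ((a : ℂ) + b * I) ^ n‖ ≤ ‖β‖ * ((2 / δ + 1) ^ n * b ^ n) := by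
      rw [norm_mul, norm_pow, ← hn.pow_abs b, ← mul_pow]
      gcongr
    have h3 : a ^ n ≤ (2 / δ) ^ n * b ^ n := by
      rw [← hn.pow_abs a, ← hn.pow_abs b, ← mul_pow]
      gcongr
    have h4 := (abs_le.1 (Complex.abs_re_le_norm (β * ((a : ℂ) + b * I) ^ n))).1
    nlinarith
  · push Not at h
    have ha : a ≠ 0 := by
      rintro rfl
      have : 0 ≤ 2 / δ * |b| := by positivity
      simp at h
      linarith
    have hapos : 0 < |a| := abs_pos.2 ha
    have hba : dist (b / a) 0 < δ := by
      rw [dist_zero_right, Real.norm_eq_abs, abs_div, div_lt_iff₀ hapos]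
      have : 2 / δ * |b| * δ = 2 * |b| := by field_simp
      nlinarith [abs_nonneg b]
    have h5 := hball hba
    have h6 : β * ((a : ℂ) + b * I) ^ n = ((a ^ n : ℝ) : ℂ) * (β * (1 + ((b / a : ℝ) : ℂ) * I) ^ n) := by
      have hac : (a : ℂ) ≠ 0 := by exact_mod_cast ha
      have : (a : ℂ) + b * I = a * (1 + ((b / a : ℝ) : ℂ) * I) := by
        push_cast; field_simp
      rw [this, mul_pow]; push_cast; ring
    rw [h6, Complex.re_ofReal_mul]
    have h7 := mul_le_mul_of_nonneg_left h5.le han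
    have h8 := mul_nonneg hK hbn
    linarith

lemma key_bound (n : ℕ) (hn : Even n) (hn2 : 2 ≤ n) (β : ℂ) (hβ : 0 < β.re) :
    ∃ c K : ℝ, 0 < c ∧ 0 < K ∧ ∀ k : ℕ, ∃ A : ℝ, 0 < A ∧ ∀ a b : ℝ,
      ‖(a : ℂ) + b * I‖ ^ k * Real.exp (-(β * ((a : ℂ) + b * I) ^ n).re) ≤
        A * Real.exp (-c * a ^ 2) * Real.exp (K * b ^ n) := by
  obtain ⟨c, K, hc, hK, h⟩ := key_lower n hn hn2 β hβ
  refine ⟨c / 2, K + c / 2, by linarith, by linarith, fun k => ?_⟩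
  refine ⟨k.factorial * (2 / c) ^ k * Real.exp (c + c / 2), by positivity, fun a b => ?_⟩
  have hsq : ∀ t : ℝ, t ^ 2 ≤ 1 + t ^ n := by
    intro t
    rw [← sq_abs, ← hn.pow_abs]
    rcases le_total |t| 1 with h1 | h1
    · have := pow_le_one₀ (n := 2) (abs_nonneg t) h1
      have := pow_nonneg (abs_nonneg t) n
      linarith
    · have := pow_le_pow_right₀ h1 hn2
      linarith
  have hab : ∀ t : ℝ, |t| ≤ 1 + t ^ n := by
    intro t
    rw [← hn.pow_abs]
    rcases le_total |t| 1 with h1 | h1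
    · have := pow_nonneg (abs_nonneg t) n
      linarith
    · have := pow_le_pow_right₀ h1 (show 1 ≤ n by omega)
      linarith [pow_one |t|]
  have h1 : ‖(a : ℂ) + b * I‖ ≤ |a| + |b| := by
    calc ‖(a : ℂ) + b * I‖ ≤ ‖(a : ℂ)‖ + ‖(b : ℂ) * I‖ := norm_add_le _ _
      _ = |a| + |b| := by simp
  have h2 : ‖(a : ℂ) + b * I‖ ^ k ≤ k.factorial * (2 / c) ^ k *
      Real.exp (c / 2 * ‖(a : ℂ) + b * I‖) := by
    have := Real.pow_div_factorial_le_exp (c / 2 * ‖(a : ℂ) + b * I‖) (by positivity) k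
    rw [div_le_iff₀ (by positivity), mul_pow] at this
    calc ‖(a : ℂ) + b * I‖ ^ k = (2 / c) ^ k * ((c / 2) ^ k * ‖(a : ℂ) + b * I‖ ^ k) := by
          rw [← mul_assoc, ← mul_pow, show 2 / c * (c / 2) = 1 by field_simp, one_pow, one_mul]
      _ ≤ (2 / c) ^ k * (Real.exp (c / 2 * ‖(a : ℂ) + b * I‖) * k.factorial) := by gcongr
      _ = _ := by ring
  calc _ ≤ (k.factorial * (2 / c) ^ k * Real.exp (c / 2 * ‖(a : ℂ) + b * I‖)) *
        Real.exp (-(β * ((a : ℂ) + b * I) ^ n).re) := by gcongr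
    _ = k.factorial * (2 / c) ^ k * Real.exp (c / 2 * ‖(a : ℂ) + b * I‖ +
        -(β * ((a : ℂ) + b * I) ^ n).re) := by rw [Real.exp_add]; ring
    _ ≤ k.factorial * (2 / c) ^ k * Real.exp ((c + c / 2) + (-(c / 2) * a ^ 2) +
        (K + c / 2) * b ^ n) := by
      refine mul_le_mul_of_nonneg_left (Real.exp_le_exp.2 ?_) (by positivity)
      nlinarith [h a b, mul_le_mul_of_nonneg_left (hab a) hc.le,
        mul_le_mul_of_nonneg_left (hab b) hc.le, mul_le_mul_of_nonneg_left (hsq a) hc.le,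
        mul_le_mul_of_nonneg_left h1 hc.le]
    _ = _ := by rw [Real.exp_add, Real.exp_add]; ring

/-- The integrand. -/
noncomputable def Ek (n : ℕ) (β : ℂ) (k : ℕ) (x : ℂ) (z : ℂ) : ℂ :=
  z ^ k * (Complex.exp (-I * x * z) * Complex.exp (-β * z ^ n))

lemma Ek_bound (n : ℕ) (hn : Even n) (hn2 : 2 ≤ n) (β : ℂ) (hβ : 0 < β.re) :
    ∃ c K : ℝ, 0 < c ∧ 0 < K ∧ ∀ k : ℕ, ∃ A : ℝ, 0 < A ∧ ∀ x a b : ℝ,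
      ‖Ek n β k x ((a : ℂ) + b * I)‖ ≤
        A * Real.exp (x * b + K * b ^ n) * Real.exp (-c * a ^ 2) := by
  obtain ⟨c, K, hc, hK, h⟩ := key_bound n hn hn2 β hβ
  refine ⟨c, K, hc, hK, fun k => ?_⟩
  obtain ⟨A, hA, h⟩ := h k
  refine ⟨A, hA, fun x a b => ?_⟩
  have h1 := h a b
  have h2 : (-I * (x : ℂ) * ((a : ℂ) + b * I)).re = x * b := by simp
  rw [Ek, norm_mul, norm_mul, norm_pow, Complex.norm_exp, Complex.norm_exp, h2, neg_mul β,
    Complex.neg_re, Real.exp_add]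
  calc _ = Real.exp (x * b) * (‖(a : ℂ) + b * I‖ ^ k *
        Real.exp (-(β * ((a : ℂ) + b * I) ^ n).re)) := by ring
    _ ≤ Real.exp (x * b) * (A * Real.exp (-c * a ^ 2) * Real.exp (K * b ^ n)) := by gcongr
    _ = _ := by ring

lemma Ek_cont (n : ℕ) (β : ℂ) (k : ℕ) (x : ℂ) : Continuous (Ek n β k x) := by
  unfold Ek; fun_prop

lemma Ek_integrable (n : ℕ) (hn : Even n) (hn2 : 2 ≤ n) (β : ℂ) (hβ : 0 < β.re) (k : ℕ)
    (x b : ℝ) : MeasureTheory.Integrable (fun a : ℝ => Ek n β k x ((a : ℂ) + b * I)) := by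
  obtain ⟨c, K, hc, hK, h⟩ := Ek_bound n hn hn2 β hβ
  obtain ⟨A, hA, h⟩ := h k
  have hg : MeasureTheory.Integrable
      (fun a : ℝ => A * Real.exp (x * b + K * b ^ n) * Real.exp (-c * a ^ 2)) :=
    (integrable_exp_neg_mul_sq hc).const_mul _
  refine hg.mono' ?_ (Filter.Eventually.of_forall fun a => h x a b)
  exact ((Ek_cont n β k x).comp (by fun_prop)).aestronglyMeasurable

/-- derivative in z -/
noncomputable def Ekd (n : ℕ) (β : ℂ) (k : ℕ) (x : ℂ) (z : ℂ) : ℂ :=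
  k * Ek n β (k - 1) x z + (-I * x) * Ek n β k x z + (-β * n) * Ek n β (k + (n - 1)) x z

lemma Ek_hasDerivAt (n : ℕ) (β : ℂ) (k : ℕ) (x z : ℂ) :
    HasDerivAt (Ek n β k x) (Ekd n β k x z) z := by
  have h1 : HasDerivAt (fun z : ℂ => -I * x * z) (-I * x) z := by
    simpa using (hasDerivAt_id z).const_mul (-I * x)
  have h2 : HasDerivAt (fun z : ℂ => -β * z ^ n) (-β * (n * z ^ (n - 1))) z :=
    (hasDerivAt_pow n z).const_mul (-β)
  have h3 := (hasDerivAt_pow k z).mul (h1.cexp.mul h2.cexp)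
  refine HasDerivAt.congr_deriv (f := Ek n β k x) h3 ?_
  simp only [Ekd, Ek, pow_add, Pi.mul_apply]
  ring

lemma Ekd_integrable (n : ℕ) (hn : Even n) (hn2 : 2 ≤ n) (β : ℂ) (hβ : 0 < β.re) (k : ℕ)
    (x b : ℝ) : MeasureTheory.Integrable (fun a : ℝ => Ekd n β k x ((a : ℂ) + b * I)) := by
  unfold Ekd
  exact (((Ek_integrable n hn hn2 β hβ _ x b).const_mul _).add
    ((Ek_integrable n hn hn2 β hβ _ x b).const_mul _)).add
    ((Ek_integrable n hn hn2 β hβ _ x b).const_mul _)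

lemma Ekd_integral (n : ℕ) (hn : Even n) (hn2 : 2 ≤ n) (β : ℂ) (hβ : 0 < β.re) (k : ℕ)
    (x b : ℝ) : ∫ a : ℝ, Ekd n β k x ((a : ℂ) + b * I) = 0 := by
  refine MeasureTheory.integral_eq_zero_of_hasDerivAt_of_integrable
    (f := fun a : ℝ => Ek n β k x ((a : ℂ) + b * I)) (fun a => ?_)
    (Ekd_integrable n hn hn2 β hβ k x b) (Ek_integrable n hn hn2 β hβ k x b)
  have h1 : HasDerivAt (fun a : ℝ => (a : ℂ) + b * I) 1 a :=
    (Complex.ofRealCLM.hasDerivAt (x := a)).add_const _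
  have h2 := (Ek_hasDerivAt n β k x ((a : ℂ) + b * I)).comp a h1
  rw [mul_one] at h2
  exact h2

lemma Ekd_bound (n : ℕ) (hn : Even n) (hn2 : 2 ≤ n) (β : ℂ) (hβ : 0 < β.re) (k : ℕ) (x R : ℝ) :
    ∃ c B : ℝ, 0 < c ∧ ∀ a b : ℝ, |b| ≤ R →
      ‖Ekd n β k x ((a : ℂ) + b * I)‖ ≤ B * Real.exp (-c * a ^ 2) := by
  obtain ⟨c, K, hc, hK, h⟩ := Ek_bound n hn hn2 β hβ
  obtain ⟨A1, hA1, h1⟩ := h (k - 1)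
  obtain ⟨A2, hA2, h2⟩ := h k
  obtain ⟨A3, hA3, h3⟩ := h (k + (n - 1))
  refine ⟨c, (k * A1 + |x| * A2 + ‖β‖ * n * A3) * Real.exp (|x| * R + K * R ^ n), hc, ?_⟩
  intro a b hb
  have he : Real.exp (x * b + K * b ^ n) ≤ Real.exp (|x| * R + K * R ^ n) := by
    have h4 : x * b ≤ |x| * R := by
      calc x * b ≤ |x * b| := le_abs_self _
        _ = |x| * |b| := abs_mul _ _
        _ ≤ _ := by gcongr
    have h5 : b ^ n ≤ R ^ n := by
      rw [← hn.pow_abs b]; gcongr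
    gcongr
  have h1 := h1 x a b
  have h2 := h2 x a b
  have h3 := h3 x a b
  set e := Real.exp (x * b + K * b ^ n)
  set e' := Real.exp (|x| * R + K * R ^ n)
  set g := Real.exp (-c * a ^ 2)
  have hg : 0 < g := Real.exp_pos _
  calc _ ≤ ‖(k : ℂ) * Ek n β (k - 1) x ((a : ℂ) + b * I)‖ +
        ‖(-I * x) * Ek n β k x ((a : ℂ) + b * I)‖ +
        ‖(-β * n) * Ek n β (k + (n - 1)) x ((a : ℂ) + b * I)‖ := norm_add₃_le
    _ = k * ‖Ek n β (k - 1) x ((a : ℂ) + b * I)‖ + |x| * ‖Ek n β k x ((a : ℂ) + b * I)‖ +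
        ‖β‖ * n * ‖Ek n β (k + (n - 1)) x ((a : ℂ) + b * I)‖ := by simp
    _ ≤ k * (A1 * e * g) + |x| * (A2 * e * g) + ‖β‖ * n * (A3 * e * g) := by gcongr
    _ ≤ k * (A1 * e' * g) + |x| * (A2 * e' * g) + ‖β‖ * n * (A3 * e' * g) := by gcongr
    _ = _ := by ring

lemma shift (n : ℕ) (hn : Even n) (hn2 : 2 ≤ n) (β : ℂ) (hβ : 0 < β.re) (k : ℕ) (x b : ℝ) :
    ∫ a : ℝ, Ek n β k x ((a : ℂ) + b * I) = ∫ a : ℝ, Ek n β k x (a : ℂ) := by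
  have hd : ∀ b : ℝ, HasDerivAt (fun b : ℝ => ∫ a : ℝ, Ek n β k x ((a : ℂ) + b * I)) 0 b := by
    intro b
    obtain ⟨c, B, hc, hB⟩ := Ekd_bound n hn hn2 β hβ k x (|b| + 1)
    have := (hasDerivAt_integral_of_dominated_loc_of_deriv_le
      (F := fun (b a : ℝ) => Ek n β k x ((a : ℂ) + b * I))
      (F' := fun (b a : ℝ) => Ekd n β k x ((a : ℂ) + b * I) * I)
      (bound := fun a => B * Real.exp (-c * a ^ 2)) (x₀ := b) (μ := MeasureTheory.volume)
      (Metric.ball_mem_nhds b one_pos)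
      (Filter.Eventually.of_forall fun b =>
        (Ek_integrable n hn hn2 β hβ k x b).aestronglyMeasurable)
      (Ek_integrable n hn hn2 β hβ k x b)
      ((Ekd_integrable n hn hn2 β hβ k x b).mul_const I).aestronglyMeasurable
      (Filter.Eventually.of_forall fun a b' hb' => ?_)
      ((integrable_exp_neg_mul_sq hc).const_mul _)
      (Filter.Eventually.of_forall fun a b' hb' => ?_)).2
    · rw [MeasureTheory.integral_mul_const, Ekd_integral n hn hn2 β hβ, zero_mul] at this
      exact this
    · rw [norm_mul, Complex.norm_I, mul_one]
      apply hB
      rw [Metric.mem_ball, Real.dist_eq] at hb'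
      have := abs_add_le (b' - b) b
      rw [sub_add_cancel] at this
      linarith
    · have h1 : HasDerivAt (fun b : ℝ => (a : ℂ) + b * I) I b' := by
        simpa using ((Complex.ofRealCLM.hasDerivAt (x := b')).mul_const I).const_add (a : ℂ)
      exact (Ek_hasDerivAt n β k x ((a : ℂ) + b' * I)).comp b' h1
  have := is_const_of_deriv_eq_zero (fun b => (hd b).differentiableAt) (fun b => (hd b).deriv) b 0
  simpa using this

lemma deriv_x (n : ℕ) (hn : Even n) (hn2 : 2 ≤ n) (β : ℂ) (hβ : 0 < β.re) (k : ℕ) (x : ℝ) :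
    HasDerivAt (fun x : ℝ => ∫ a : ℝ, Ek n β k x (a : ℂ))
      (-I * ∫ a : ℝ, Ek n β (k + 1) x (a : ℂ)) x := by
  obtain ⟨c, K, hc, hK, h⟩ := Ek_bound n hn hn2 β hβ
  obtain ⟨A, hA, h⟩ := h (k + 1)
  have hint : ∀ (k : ℕ) (x : ℝ), MeasureTheory.Integrable (fun a : ℝ => Ek n β k x (a : ℂ)) := by
    intro k x
    simpa using Ek_integrable n hn hn2 β hβ k x 0
  have := (hasDerivAt_integral_of_dominated_loc_of_deriv_le
      (F := fun (x a : ℝ) => Ek n β k x (a : ℂ))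
      (F' := fun (x a : ℝ) => -I * Ek n β (k + 1) x (a : ℂ))
      (bound := fun a => A * Real.exp (-c * a ^ 2)) (x₀ := x) (μ := MeasureTheory.volume)
      (Metric.ball_mem_nhds x one_pos)
      (Filter.Eventually.of_forall fun x => (hint k x).aestronglyMeasurable)
      (hint k x) ((hint (k + 1) x).const_mul (-I)).aestronglyMeasurable
      (Filter.Eventually.of_forall fun a x' hx' => ?_)
      ((integrable_exp_neg_mul_sq hc).const_mul _)
      (Filter.Eventually.of_forall fun a x' hx' => ?_)).2
  · rw [MeasureTheory.integral_const_mul] at this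
    exact this
  · have h0 := h x' a 0
    rw [norm_mul, norm_neg, Complex.norm_I, one_mul]
    have hz : (0 : ℝ) ^ n = 0 := zero_pow (by omega)
    simpa [hz] using h0
  · have h1 : HasDerivAt (fun x : ℝ => -I * (x : ℂ) * (a : ℂ)) (-I * 1 * a) x' :=
      ((Complex.ofRealCLM.hasDerivAt (x := x')).const_mul (-I)).mul_const (a : ℂ)
    have h2 := (h1.cexp.mul_const (Complex.exp (-β * (a : ℂ) ^ n))).const_mul ((a : ℂ) ^ k)
    refine h2.congr_deriv ?_
    simp only [Ek, pow_succ]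
    ring

lemma iter_H (μ : ℕ) (hμ : 1 ≤ μ) (β : ℂ) (hβ : 0 < β.re) (j : ℕ) :
    iteratedDeriv j (Hfun μ β) = fun x : ℝ =>
      (1 / (2 * Real.pi : ℂ)) * ((-I) ^ j * ∫ a : ℝ, Ek (2 * μ) β j x (a : ℂ)) := by
  induction j with
  | zero =>
    rw [iteratedDeriv_zero]
    funext x
    simp [Hfun, Ek]
  | succ j ih =>
    rw [iteratedDeriv_succ, ih]
    funext x
    have := ((deriv_x (2 * μ) (even_two_mul μ) (by omega) β hβ j x).const_mul
      ((-I) ^ j)).const_mul (1 / (2 * Real.pi : ℂ))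
    rw [this.deriv, pow_succ]
    ring

lemma one_decay (μ : ℕ) (hμ : 1 ≤ μ) (β : ℂ) (hβ : 0 < β.re) :
    ∃ e : ℝ, 0 < e ∧ ∀ j : ℕ, ∃ A : ℝ, 0 < A ∧ ∀ x : ℝ,
      ‖iteratedDeriv j (Hfun μ β) x‖ ≤
        A * Real.exp (-e * |x| ^ ((2 * μ : ℝ) / (2 * μ - 1))) := by
  have hn2 : 2 ≤ 2 * μ := by omega
  have hn : Even (2 * μ) := even_two_mul μ
  obtain ⟨c, K, hc, hK, h⟩ := Ek_bound (2 * μ) hn hn2 β hβ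
  obtain ⟨e, he, he1, heK⟩ : ∃ e : ℝ, 0 < e ∧ e ≤ 1 ∧ K * e ≤ 1 / 2 := by
    refine ⟨min 1 (1 / (2 * K)), by positivity, min_le_left _ _, ?_⟩
    calc K * min 1 (1 / (2 * K)) ≤ K * (1 / (2 * K)) := by gcongr; exact min_le_right _ _
      _ = 1 / 2 := by field_simp
  refine ⟨e / 2, by linarith, fun j => ?_⟩
  obtain ⟨A, hA, h⟩ := h j
  refine ⟨‖(1 / (2 * Real.pi : ℂ))‖ * (A * √(Real.pi / c)),
    mul_pos (norm_pos_iff.2 (by simp [Real.pi_ne_zero])) (by positivity), fun x => ?_⟩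
  have hμ' : (1 : ℝ) ≤ μ := by exact_mod_cast hμ
  set q : ℝ := (2 * μ : ℝ) / (2 * μ - 1) with hq
  set r : ℝ := 1 / (2 * μ - 1) with hr
  have hd : (2 * μ - 1 : ℝ) ≠ 0 := by linarith
  have hrpos : 0 < r := by rw [hr]; apply one_div_pos.2; linarith
  have hqpos : 0 < q := by rw [hq]; apply div_pos <;> linarith
  have hq1 : |x| * |x| ^ r = |x| ^ q := by
    have : q = 1 + r := by rw [hq, hr]; field_simp; ring
    rw [this, Real.rpow_add_of_nonneg (abs_nonneg x) zero_le_one hrpos.le, Real.rpow_one]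
  have hq2 : (|x| ^ r) ^ (2 * μ) = |x| ^ q := by
    rw [← Real.rpow_natCast, ← Real.rpow_mul (abs_nonneg x)]
    congr 1
    rw [hq, hr]; push_cast; field_simp
  have hqn : 0 ≤ |x| ^ q := by positivity
  obtain ⟨b, hb1, hb2⟩ : ∃ b : ℝ, x * b = -(e * |x| ^ q) ∧ b ^ (2 * μ) = e ^ (2 * μ) * |x| ^ q := by
    rcases le_total 0 x with hx | hx
    · refine ⟨-(e * |x| ^ r), ?_, ?_⟩
      · rw [← hq1]; nth_rewrite 2 [abs_of_nonneg hx]; ring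
      · rw [hn.neg_pow, mul_pow, hq2]
    · refine ⟨e * |x| ^ r, ?_, ?_⟩
      · rw [← hq1]; nth_rewrite 2 [abs_of_nonpos hx]; ring
      · rw [mul_pow, hq2]
  have hexp : x * b + K * b ^ (2 * μ) ≤ -(e / 2) * |x| ^ q := by
    have h1 : e ^ (2 * μ) ≤ e ^ 2 := pow_le_pow_of_le_one he.le he1 hn2
    have h2 : K * e ^ (2 * μ) ≤ e / 2 := by nlinarith
    rw [hb1, hb2]
    nlinarith [mul_le_mul_of_nonneg_right h2 hqn]
  rw [iter_H μ hμ β hβ j]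
  simp only
  rw [← shift (2 * μ) hn hn2 β hβ j x b, norm_mul, norm_mul, norm_pow, norm_neg, Complex.norm_I,
    one_pow, one_mul, mul_assoc]
  gcongr
  calc ‖∫ a : ℝ, Ek (2 * μ) β j x ((a : ℂ) + b * I)‖
      ≤ ∫ a : ℝ, A * Real.exp (x * b + K * b ^ (2 * μ)) * Real.exp (-c * a ^ 2) :=
        MeasureTheory.norm_integral_le_of_norm_le ((integrable_exp_neg_mul_sq hc).const_mul _)
          (Filter.Eventually.of_forall fun a => h x a b)
    _ = A * Real.exp (x * b + K * b ^ (2 * μ)) * √(Real.pi / c) := by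
        rw [MeasureTheory.integral_const_mul, integral_gaussian]
    _ ≤ A * Real.exp (-(e / 2) * |x| ^ q) * √(Real.pi / c) := by gcongr
    _ = _ := by ring

/-- `H_{2μ}^β` and all its derivatives have super-exponential (generalized Gaussian)
decay at infinity. -/
theorem Hfun_derivatives_decay (μ : ℕ) (hμ : 1 ≤ μ) (β : ℂ) (hβ : 0 < β.re) :
    ∀ N : ℕ, ∃ C : ℝ, 0 < C ∧ ∀ x : ℝ,
      ∑ j ∈ Finset.range (N + 1), ‖iteratedDeriv j (Hfun μ β) x‖ ≤
        C * Real.exp (-(1 / C) * |x| ^ ((2 * μ : ℝ) / (2 * μ - 1))) := by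
  intro N
  obtain ⟨e, he, h⟩ := one_decay μ hμ β hβ
  choose A hA h using h
  set S : ℝ := ∑ j ∈ Finset.range (N + 1), A j with hS
  have hS0 : 0 ≤ S := Finset.sum_nonneg fun j _ => (hA j).le
  have hC : 0 < S + 1 / e := by positivity
  refine ⟨S + 1 / e, hC, fun x => ?_⟩
  have hCe : 1 / (S + 1 / e) ≤ e := by
    rw [div_le_iff₀ hC, mul_add, mul_one_div_cancel he.ne']
    have := mul_nonneg he.le hS0
    linarith
  have hqn : 0 ≤ |x| ^ ((2 * μ : ℝ) / (2 * μ - 1)) := by positivity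
  calc _ ≤ ∑ j ∈ Finset.range (N + 1),
        A j * Real.exp (-e * |x| ^ ((2 * μ : ℝ) / (2 * μ - 1))) :=
        Finset.sum_le_sum fun j _ => h j x
    _ = S * Real.exp (-e * |x| ^ ((2 * μ : ℝ) / (2 * μ - 1))) := by rw [← Finset.sum_mul]
    _ ≤ _ := by
      have : 0 ≤ 1 / e := by positivity
      gcongr
      linarith
end

section
/- Let λ ∈ ℝ and let a = (a_ℓ)_{ℓ∈ℤ} be the finitely supported sequence with a_{−1} = λ(2−λ)(λ−1)/6, a₀ = (2−λ)(1−λ²)/2, a₁ = λ(2−λ)(1+λ)/2, a₂ = −λ(1−λ²)/6, and a_ℓ = 0 otherwise. Then for every ξ ∈ ℝ, |F_a(e^{iξ})|² = 1 − (4/9) λ(2−λ)(1−λ²) sin⁴(ξ/2) · ( 3 + 4λ(1−λ) sin²(ξ/2) ). -/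
open Complex

/-- The amplification factor sequence of the O3 scheme with Courant parameter `λ`. -/
noncomputable def O3seq (lam : ℝ) : ℤ → ℂ := fun ℓ =>
  if ℓ = -1 then (lam * (2 - lam) * (lam - 1) / 6 : ℝ)
  else if ℓ = 0 then ((2 - lam) * (1 - lam ^ 2) / 2 : ℝ)
  else if ℓ = 1 then (lam * (2 - lam) * (1 + lam) / 2 : ℝ)
  else if ℓ = 2 then (-(lam * (1 - lam ^ 2)) / 6 : ℝ)
  else 0

/-- Modulus of the amplification factor of the O3 scheme:
`|F_a (e^{iξ})|² = 1 - (4/9) λ(2-λ)(1-λ²) sin⁴(ξ/2) (3 + 4λ(1-λ) sin²(ξ/2))`. -/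
theorem O3_amplification_modulus (lam : ℝ) :
    ∀ ξ : ℝ,
      ‖∑' ℓ : ℤ, O3seq lam ℓ * Complex.exp (Complex.I * ξ) ^ ℓ‖ ^ 2 =
        1 - 4 / 9 * lam * (2 - lam) * (1 - lam ^ 2) * Real.sin (ξ / 2) ^ 4 *
          (3 + 4 * lam * (1 - lam) * Real.sin (ξ / 2) ^ 2) := by
  intro ξ
  have hsum : ∑' ℓ : ℤ, O3seq lam ℓ * Complex.exp (Complex.I * ξ) ^ ℓ =
      ∑ ℓ ∈ ({-1, 0, 1, 2} : Finset ℤ), O3seq lam ℓ * Complex.exp (Complex.I * ξ) ^ ℓ := by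
    apply tsum_eq_sum
    intro b hb
    simp only [Finset.mem_insert, Finset.mem_singleton, not_or] at hb
    simp [O3seq, hb]
  have hz : Complex.exp (Complex.I * ξ) = ⟨Real.cos ξ, Real.sin ξ⟩ := by
    rw [mul_comm, Complex.exp_mul_I, ← Complex.ofReal_cos, ← Complex.ofReal_sin]
    apply Complex.ext <;> simp [-Complex.ofReal_cos, -Complex.ofReal_sin]
  have hzi : (Complex.exp (Complex.I * ξ))⁻¹ = ⟨Real.cos ξ, -Real.sin ξ⟩ := by
    rw [← Complex.exp_neg, ← mul_neg, mul_comm, Complex.exp_mul_I, ← Complex.ofReal_neg,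
      ← Complex.ofReal_cos, ← Complex.ofReal_sin]
    apply Complex.ext <;> simp [-Complex.ofReal_cos, -Complex.ofReal_sin]
  have h2 : ∑ ℓ ∈ ({-1, 0, 1, 2} : Finset ℤ), O3seq lam ℓ * Complex.exp (Complex.I * ξ) ^ ℓ =
      ((lam * (2 - lam) * (lam - 1) / 6 : ℝ) : ℂ) * (Complex.exp (Complex.I * ξ))⁻¹
      + ((2 - lam) * (1 - lam ^ 2) / 2 : ℝ)
      + ((lam * (2 - lam) * (1 + lam) / 2 : ℝ) : ℂ) * Complex.exp (Complex.I * ξ)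
      + ((-(lam * (1 - lam ^ 2)) / 6 : ℝ) : ℂ)
        * (Complex.exp (Complex.I * ξ) * Complex.exp (Complex.I * ξ)) := by
    rw [Finset.sum_insert (by decide), Finset.sum_insert (by decide),
      Finset.sum_insert (by decide), Finset.sum_singleton, zpow_neg_one, zpow_zero, zpow_one,
      zpow_two]
    have e1 : O3seq lam (-1) = (lam * (2 - lam) * (lam - 1) / 6 : ℝ) := if_pos rfl
    have e2 : O3seq lam 0 = ((2 - lam) * (1 - lam ^ 2) / 2 : ℝ) := rfl
    have e3 : O3seq lam 1 = (lam * (2 - lam) * (1 + lam) / 2 : ℝ) := rfl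
    have e4 : O3seq lam 2 = (-(lam * (1 - lam ^ 2)) / 6 : ℝ) := rfl
    rw [e1, e2, e3, e4]
    ring
  have hcos : Real.cos ξ = 1 - 2 * Real.sin (ξ / 2) ^ 2 := by
    have h := Real.cos_two_mul (ξ / 2)
    have h' := Real.sin_sq_add_cos_sq (ξ / 2)
    rw [show 2 * (ξ / 2) = ξ by ring] at h
    linarith
  have hsin : Real.sin ξ ^ 2 = 1 - (1 - 2 * Real.sin (ξ / 2) ^ 2) ^ 2 := by
    rw [← hcos, Real.sin_sq]
  rw [hsum, h2, hzi, hz, Complex.sq_norm, Complex.normSq_apply]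
  simp only [Complex.add_re, Complex.add_im, Complex.mul_re, Complex.mul_im, Complex.ofReal_re,
    Complex.ofReal_im]
  rw [hcos]
  generalize Real.sin ξ = S at *
  generalize Real.sin (ξ / 2) = s at *
  have hS4 : S ^ 4 = (1 - (1 - 2 * s ^ 2) ^ 2) ^ 2 := by rw [← hsin]; ring
  ring_nf
  ring_nf at hsin hS4
  rw [hsin, hS4]
  ring
end
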